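/- Let θ₁ < θ₂ with (θ₁,θ₂) ∩ E = ∅, and let λ̄ ∈ ℝ and f₁, f₂ ∈ S_st^{λ̄} with 𝔼[f₁(0,·)] = θ₁ and 𝔼[f₂(0,·)] = θ₂. Then there exists a measurable Ω̄ ⊆ Ω with ℙ(Ω̄) = 1 such that lim_{ε→0⁺} u_θ^ε(1,0,ω) = λ̄ for every θ ∈ (θ₁,θ₂) and every ω ∈ Ω̄. Moreover, for every θ ∈ (θ₁,θ₂) there exists a measurable Ω₀^θ ⊆ Ω with ℙ(Ω₀^θ) = 1 such that for every ω ∈ Ω₀^θ and all T, M > 0, lim_{ε→0⁺} sup_{t∈[0,T]} sup_{x∈[−M,M]} |u_θ^ε(t,x,ω) − tλ̄ − θx| = 0. -/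

import Mathlib

open MeasureTheory Filter Set

def IsViscositySubsolution (alpha : ℝ → ℝ) (h : ℝ → ℝ → ℝ) (v : ℝ → ℝ → ℝ) : Prop :=
  ∀ t₀ x₀ : ℝ, 0 < t₀ →
    ∀ φ : ℝ × ℝ → ℝ, ContDiffOn ℝ 2 φ {q : ℝ × ℝ | 0 < q.1} →
      IsLocalMax (fun q : ℝ × ℝ => v q.1 q.2 - φ q) (t₀, x₀) →
      deriv (fun t => φ (t, x₀)) t₀ ≤
        alpha x₀ * deriv (deriv fun x => φ (t₀, x)) x₀ +
          h (deriv (fun x => φ (t₀, x)) x₀) x₀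

def IsViscositySupersolution (alpha : ℝ → ℝ) (h : ℝ → ℝ → ℝ) (v : ℝ → ℝ → ℝ) : Prop :=
  ∀ t₀ x₀ : ℝ, 0 < t₀ →
    ∀ φ : ℝ × ℝ → ℝ, ContDiffOn ℝ 2 φ {q : ℝ × ℝ | 0 < q.1} →
      IsLocalMin (fun q : ℝ × ℝ => v q.1 q.2 - φ q) (t₀, x₀) →
      alpha x₀ * deriv (deriv fun x => φ (t₀, x)) x₀ +
          h (deriv (fun x => φ (t₀, x)) x₀) x₀ ≤
        deriv (fun t => φ (t, x₀)) t₀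

def IsViscositySolution (alpha : ℝ → ℝ) (h : ℝ → ℝ → ℝ) (v : ℝ → ℝ → ℝ) : Prop :=
  IsViscositySubsolution alpha h v ∧ IsViscositySupersolution alpha h v

structure HJSetting {Ω : Type} [MeasurableSpace Ω] (P : Measure Ω) (τ : ℝ → Ω → Ω)
    (a : ℝ → Ω → ℝ) (H : ℝ → ℝ → Ω → ℝ) (G_L G_U : ℝ → ℝ) : Prop where
  prob : IsProbabilityMeasure P
  meas_tau : Measurable fun q : ℝ × Ω => τ q.1 q.2
  mp_tau : ∀ x, MeasurePreserving (τ x) P P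
  tau_zero : ∀ ω, τ 0 ω = ω
  tau_add : ∀ x y ω, τ (x + y) ω = τ x (τ y ω)
  ergodic : ∀ A : Set Ω, MeasurableSet A → (∀ x, τ x ⁻¹' A = A) → P A = 0 ∨ P A = 1
  meas_a : Measurable fun q : ℝ × Ω => a q.1 q.2
  a_pos : ∀ x ω, 0 < a x ω
  a_le_one : ∀ x ω, a x ω ≤ 1
  a_stat : ∀ x ω, a x ω = a 0 (τ x ω)
  a_sqrt_lip : ∃ κ > (0:ℝ), ∀ x ω, |Real.sqrt (a x ω) - Real.sqrt (a 0 ω)| ≤ κ * |x|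
  meas_H : Measurable fun q : ℝ × ℝ × Ω => H q.1 q.2.1 q.2.2
  H_stat : ∀ p x ω, H p x ω = H p 0 (τ x ω)
  GL_cont : Continuous G_L
  GU_cont : Continuous G_U
  GL_even : ∀ p, G_L (-p) = G_L p
  GU_even : ∀ p, G_U (-p) = G_U p
  GL_mono : MonotoneOn G_L (Ici 0)
  GU_mono : MonotoneOn G_U (Ici 0)
  GL_coercive : Tendsto G_L atTop atTop
  GU_coercive : Tendsto G_U atTop atTop
  H_lower : ∀ p ω, G_L p ≤ H p 0 ω
  H_upper : ∀ p ω, H p 0 ω ≤ G_U p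
  H_lip : ∀ R > (0:ℝ), ∃ K > (0:ℝ), ∀ p q ω, |p| ≤ R → |q| ≤ R →
      |H p 0 ω - H q 0 ω| ≤ K * |p - q|
  H_mod : ∀ R > (0:ℝ), ∃ m : ℝ → ℝ, (∀ r, 0 ≤ m r) ∧ MonotoneOn m (Ici 0) ∧
      Tendsto m (nhdsWithin 0 (Ioi 0)) (nhds 0) ∧
      ∀ p x ω, |p| ≤ R → |H p x ω - H p 0 ω| ≤ m |x|

/-- `f` is a stationary solution of `a(x,ω) f' + H(f,x,ω) = lam`. -/
def StatSol {Ω : Type} [MeasurableSpace Ω] (P : Measure Ω) (τ : ℝ → Ω → Ω)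
    (a : ℝ → Ω → ℝ) (H : ℝ → ℝ → Ω → ℝ) (lam : ℝ) (f : ℝ → Ω → ℝ) : Prop :=
  (Measurable fun q : ℝ × Ω => f q.1 q.2) ∧
  (∀ x ω, f x ω = f 0 (τ x ω)) ∧
  (∀ ω, ContDiff ℝ 1 fun x => f x ω) ∧
  (∀ᵐ ω ∂P, (∃ M, ∀ x, |f x ω| ≤ M) ∧
    ∀ x, a x ω * deriv (fun y => f y ω) x + H (f x ω) x ω = lam)

/-- The set `E` of expectations `𝔼[f(0,·)]` over all stationary solutions `f`. -/
def Eset {Ω : Type} [MeasurableSpace Ω] (P : Measure Ω) (τ : ℝ → Ω → Ω)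
    (a : ℝ → Ω → ℝ) (H : ℝ → ℝ → Ω → ℝ) : Set ℝ :=
  {θ | ∃ lam f, StatSol P τ a H lam f ∧ (∫ ω, f 0 ω ∂P) = θ}

/-- A jointly measurable, measure-preserving, ergodic flow on a probability space. -/
structure IsErgodicFlow {Ω : Type} [MeasurableSpace Ω] (P : Measure Ω) (τ : ℝ → Ω → Ω) : Prop where
  prob : IsProbabilityMeasure P
  meas : Measurable fun q : ℝ × Ω => τ q.1 q.2
  mp : ∀ x, MeasurePreserving (τ x) P P
  zero : ∀ ω, τ 0 ω = ω
  add : ∀ x y ω, τ (x + y) ω = τ x (τ y ω)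
  ergodic : ∀ A : Set Ω, MeasurableSet A → (∀ x, τ x ⁻¹' A = A) → P A = 0 ∨ P A = 1

namespace IsErgodicFlow

variable {Ω : Type} [MeasurableSpace Ω] {P : Measure Ω} {τ : ℝ → Ω → Ω}

lemma reverse (hF : IsErgodicFlow P τ) : IsErgodicFlow P fun x => τ (-x) where
  prob := hF.prob
  meas := hF.meas.comp ((measurable_fst.neg).prodMk measurable_snd)
  mp x := hF.mp (-x)
  zero ω := by simpa using hF.zero ω
  add x y ω := by rw [neg_add, hF.add]
  ergodic A hA h := hF.ergodic A hA fun x => by simpa using h (-x)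

lemma exists_invariant_set (hF : IsErgodicFlow P τ) {Q : Ω → Prop} (hQ : ∀ᵐ ω ∂P, Q ω)
    (hinv : ∀ x ω, Q ω → Q (τ x ω)) :
    ∃ G : Set Ω, MeasurableSet G ∧ (∀ᵐ ω ∂P, ω ∈ G) ∧ (∀ x ω, τ x ω ∈ G ↔ ω ∈ G) ∧
      ∀ ω ∈ G, Q ω := by
  have := hF.prob
  obtain ⟨N, hNsub, hN, hN0⟩ := exists_measurable_superset_of_null (ae_iff.1 hQ)
  have hm : MeasurableSet {q : Ω × ℝ | τ q.2 q.1 ∈ N} := (hF.meas.comp measurable_swap) hN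
  let G : Set Ω := {ω | volume {x : ℝ | τ x ω ∈ N} = 0}
  have hG : MeasurableSet G :=
    measurable_measure_prodMk_left (ν := (volume : Measure ℝ)) hm (measurableSet_singleton 0)
  have hsub : ∀ x ω, ω ∈ G → τ x ω ∈ G := by
    intro x ω hω
    have h1 : {y : ℝ | τ y (τ x ω) ∈ N} = (fun y => y + x) ⁻¹' {y : ℝ | τ y ω ∈ N} := by
      ext y; simp [hF.add]
    change volume {y : ℝ | τ y (τ x ω) ∈ N} = 0
    rw [h1, measure_preimage_add_right]
    exact hω
  refine ⟨G, hG, ?_, ?_, ?_⟩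
  · have h0 : (P.prod volume) {q : Ω × ℝ | τ q.2 q.1 ∈ N} = 0 := by
      rw [Measure.prod_apply_symm hm]
      have : ∀ y : ℝ, P ((fun x => (x, y)) ⁻¹' {q : Ω × ℝ | τ q.2 q.1 ∈ N}) = 0 := fun y => by
        have := (hF.mp y).measure_preimage hN.nullMeasurableSet
        rw [hN0] at this
        exact this
      rw [lintegral_congr this, lintegral_zero]
    exact Measure.measure_ae_null_of_prod_null h0
  · refine fun x ω => ⟨fun h => ?_, hsub x ω⟩
    have := hsub (-x) _ h
    rwa [← hF.add, neg_add_cancel, hF.zero] at this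
  · intro ω hω
    have : ∃ x : ℝ, τ x ω ∉ N := by
      by_contra! hc
      have h2 : volume {x : ℝ | τ x ω ∈ N} = 0 := hω
      rw [show {x : ℝ | τ x ω ∈ N} = univ from eq_univ_of_forall hc] at h2
      simp at h2
    obtain ⟨x, hx⟩ := this
    have hq : Q (τ x ω) := by
      by_contra hc
      exact hx (hNsub hc)
    have := hinv (-x) _ hq
    rwa [← hF.add, neg_add_cancel, hF.zero] at this

lemma ae_mem_or_ae_notMem (hF : IsErgodicFlow P τ) {B : Set Ω} (hB : MeasurableSet B)
    (hinv : ∀ x ω, ω ∈ B → τ x ω ∈ B) : (∀ᵐ ω ∂P, ω ∈ B) ∨ ∀ᵐ ω ∂P, ω ∉ B := by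
  have := hF.prob
  have h : ∀ x, τ x ⁻¹' B = B := fun x => by
    ext ω
    refine ⟨fun h => ?_, hinv x ω⟩
    have := hinv (-x) _ h
    rwa [← hF.add, neg_add_cancel, hF.zero] at this
  rcases hF.ergodic B hB h with h0 | h1
  · right
    exact measure_eq_zero_iff_ae_notMem.1 h0
  · left
    exact (prob_compl_eq_zero_iff hB).2 h1

end IsErgodicFlow

/-- Maximal ergodic inequality, in the form: if almost every orbit has a positive Birkhoff sum then
the integral is nonnegative. -/
lemma integral_nonneg_of_ae_exists_birkhoffSum_pos {Ω : Type} [MeasurableSpace Ω] {P : Measure Ω}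
    [IsProbabilityMeasure P] {T : Ω → Ω} (hT : MeasurePreserving T P P) {ψ : Ω → ℝ}
    (hψ : Measurable ψ) (hint : Integrable ψ P)
    (hpos : ∀ᵐ ω ∂P, ∃ n, 0 < birkhoffSum T ψ n ω) : 0 ≤ ∫ ω, ψ ω ∂P := by
  let M : ℕ → Ω → ℝ := fun n => Nat.rec (fun _ => 0) (fun _ m ω => max 0 (ψ ω + m (T ω))) n
  have hM0 : M 0 = fun _ => 0 := rfl
  have hMs : ∀ n, M (n + 1) = fun ω => max 0 (ψ ω + M n (T ω)) := fun n => rfl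
  have hmeas : ∀ n, Measurable (M n) := by
    intro n
    induction n with
    | zero => exact measurable_const
    | succ n ih => rw [hMs]; exact measurable_const.max (hψ.add (ih.comp hT.measurable))
  have hMint : ∀ n, Integrable (M n) P := by
    intro n
    induction n with
    | zero => simp [hM0]
    | succ n ih =>
      rw [hMs]
      exact (integrable_zero Ω ℝ P).sup (hint.add (hT.integrable_comp_of_integrable ih))
  have hnn : ∀ n ω, 0 ≤ M n ω := by
    intro n ω
    cases n with
    | zero => simp [hM0]
    | succ n => simp [hMs]
  have hmono : ∀ n ω, M n ω ≤ M (n + 1) ω := by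
    intro n
    induction n with
    | zero => exact fun ω => hnn 1 ω
    | succ n ih =>
      intro ω
      rw [hMs n, hMs (n + 1)]
      exact max_le_max le_rfl (by linarith [ih (T ω)])
  have hmono' : ∀ ω, Monotone fun n => M n ω := fun ω => monotone_nat_of_le_succ fun n => hmono n ω
  have hsum : ∀ n ω, birkhoffSum T ψ n ω ≤ M n ω := by
    intro n
    induction n with
    | zero => intro ω; simp [hM0]
    | succ n ih =>
      intro ω
      rw [birkhoffSum_succ', hMs]
      exact le_max_of_le_right (by linarith [ih (T ω)])
  let S : ℕ → Set Ω := fun n => {ω | 0 < M (n + 1) ω}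
  have hS : ∀ n, MeasurableSet (S n) := fun n => measurableSet_lt measurable_const (hmeas (n + 1))
  have hkey : ∀ n, 0 ≤ ∫ ω, (S n).indicator ψ ω ∂P := by
    intro n
    have h1 : ∀ ω, M (n + 1) ω - M (n + 1) (T ω) ≤ (S n).indicator ψ ω := by
      intro ω
      by_cases h : 0 < M (n + 1) ω
      · rw [indicator_of_mem (show ω ∈ S n from h)]
        have h2 : M (n + 1) ω = ψ ω + M n (T ω) := by
          rw [hMs] at h ⊢
          rcases lt_max_iff.1 h with h | h
          · exact absurd h (lt_irrefl _)
          · exact max_eq_right h.le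
        linarith [hmono n (T ω)]
      · rw [indicator_of_notMem (show ω ∉ S n from h)]
        linarith [hnn (n + 1) (T ω), not_lt.1 h]
    have hcomp : Integrable (fun ω => M (n + 1) (T ω)) P := hT.integrable_comp_of_integrable (hMint (n + 1))
    have h2 : ∫ ω, (M (n + 1) ω - M (n + 1) (T ω)) ∂P = 0 := by
      rw [integral_sub (hMint (n + 1)) hcomp, sub_eq_zero]
      have := integral_map hT.measurable.aemeasurable (μ := P) (f := M (n + 1))
        (hmeas (n + 1)).aestronglyMeasurable
      rw [hT.map_eq] at this
      exact this
    rw [← h2]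
    exact integral_mono ((hMint (n + 1)).sub hcomp) (hint.indicator (hS n)) h1
  have hlim : Tendsto (fun n => ∫ ω, (S n).indicator ψ ω ∂P) atTop (nhds (∫ ω, ψ ω ∂P)) := by
    refine tendsto_integral_of_dominated_convergence (fun ω => |ψ ω|)
      (fun n => (hψ.indicator (hS n)).aestronglyMeasurable) hint.abs
      (fun n => ae_of_all _ fun ω => ?_) ?_
    · simpa using norm_indicator_le_norm_self (s := S n) ψ ω
    · filter_upwards [hpos] with ω ⟨n, hn⟩
      refine tendsto_const_nhds.congr' ?_
      filter_upwards [eventually_ge_atTop n] with m hm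
      rw [indicator_of_mem]
      exact (hn.trans_le (hsum n ω)).trans_le (hmono' ω (show n ≤ m + 1 by omega))
  exact ge_of_tendsto' hlim hkey

/-- Joint measurability of a parametric interval integral with a variable endpoint. -/
lemma measurable_intervalIntegral_uncurry {α : Type*} [MeasurableSpace α] {f : ℝ → α → ℝ}
    (hf : Measurable fun q : ℝ × α => f q.1 q.2) (s : ℝ) :
    Measurable fun q : ℝ × α => ∫ r in s..q.1, f r q.2 := by
  have key : ∀ {l u : ℝ × α → ℝ}, Measurable l → Measurable u →
      Measurable fun q : ℝ × α => ∫ r in Ioc (l q) (u q), f r q.2 := by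
    intro l u hl hu
    have h1 : ∀ q : ℝ × α, ∫ r in Ioc (l q) (u q), f r q.2 =
        ∫ r, {p : (ℝ × α) × ℝ | l p.1 < p.2 ∧ p.2 ≤ u p.1}.indicator
          (fun p => f p.2 p.1.2) (q, r) := by
      intro q
      rw [← integral_indicator measurableSet_Ioc]
      congr 1
    simp_rw [h1]
    refine (StronglyMeasurable.integral_prod_right (ν := volume) (Measurable.stronglyMeasurable ?_)).measurable
    refine Measurable.indicator ?_ ?_
    · exact hf.comp (measurable_snd.prodMk (measurable_snd.comp measurable_fst))
    · exact (measurableSet_lt (hl.comp measurable_fst) measurable_snd).inter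
        (measurableSet_le measurable_snd (hu.comp measurable_fst))
  simp only [intervalIntegral]
  exact (key measurable_const measurable_fst).sub (key measurable_fst measurable_const)

lemma integral_lower_bound_of_nat {q : ℝ → ℝ} {C N : ℝ}
    (hq : ∀ s t, IntervalIntegrable q volume s t) (hC : ∀ r, |q r| ≤ C)
    (hN : ∀ m : ℕ, -N ≤ ∫ r in (0:ℝ)..m, q r) {x : ℝ} (hx : 0 ≤ x) :
    -(N + C) ≤ ∫ r in (0:ℝ)..x, q r := by
  have h1 := hN ⌊x⌋₊
  have h2 : ‖∫ r in (⌊x⌋₊ : ℝ)..x, q r‖ ≤ C * |x - ⌊x⌋₊| :=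
    intervalIntegral.norm_integral_le_of_norm_le_const fun r _ => hC r
  have h3 : |x - ⌊x⌋₊| ≤ 1 := by
    rw [abs_le]
    constructor <;> linarith [Nat.floor_le hx, Nat.lt_floor_add_one x]
  have h4 := mul_le_mul_of_nonneg_left h3 ((abs_nonneg _).trans (hC 0))
  rw [← intervalIntegral.integral_add_adjacent_intervals (hq 0 ⌊x⌋₊) (hq ⌊x⌋₊ x)]
  rw [Real.norm_eq_abs] at h2
  linarith [(abs_le.1 h2).1]

namespace IsErgodicFlow

variable {Ω : Type} [MeasurableSpace Ω] {P : Measure Ω} {τ : ℝ → Ω → Ω}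

lemma measurable_orbit (hF : IsErgodicFlow P τ) (ω : Ω) : Measurable fun r => τ r ω :=
  hF.meas.comp (measurable_id.prodMk measurable_const)

lemma intervalIntegrable_orbit (hF : IsErgodicFlow P τ) {φ : Ω → ℝ} (hφ : Measurable φ) {C : ℝ}
    {ω : Ω} (hb : ∀ x, |φ (τ x ω)| ≤ C) (s t : ℝ) :
    IntervalIntegrable (fun r => φ (τ r ω)) volume s t :=
  (intervalIntegrable_const (c := C)).mono_fun
    (hφ.comp (hF.measurable_orbit ω)).aestronglyMeasurable
    (ae_of_all _ fun r => (hb r).trans (le_abs_self C))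

/-- If `φ` is bounded along orbits and has positive mean, then the integrals of `φ` along almost
every forward orbit are bounded below. -/
lemma ae_orbit_integral_bddBelow (hF : IsErgodicFlow P τ) {φ : Ω → ℝ} (hφ : Measurable φ) {C : ℝ}
    (hb : ∀ᵐ ω ∂P, ∀ x, |φ (τ x ω)| ≤ C) (hpos : 0 < ∫ ω, φ ω ∂P) :
    ∀ᵐ ω ∂P, ∃ N : ℕ, ∀ m : ℕ, -(N : ℝ) ≤ ∫ r in (0:ℝ)..m, φ (τ r ω) := by
  have := hF.prob
  have hC : 0 ≤ C := by
    obtain ⟨ω, hω⟩ := hb.exists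
    exact (abs_nonneg _).trans (hω 0)
  have hjm : Measurable fun q : ℝ × Ω => φ (τ q.1 q.2) := hφ.comp hF.meas
  obtain ⟨G, hG, hGae, hGinv, hGb⟩ := hF.exists_invariant_set hb fun x ω h y => by
    rw [← hF.add]; exact h _
  have hI := fun ω (hω : ω ∈ G) => hF.intervalIntegrable_orbit hφ (hGb ω hω)
  have hshift : ∀ z ω x, ∫ r in (0:ℝ)..x, φ (τ r (τ z ω)) = ∫ r in z..(x + z), φ (τ r ω) := by
    intro z ω x
    simp_rw [← hF.add]
    rw [intervalIntegral.integral_comp_add_right (fun r => φ (τ r ω))]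
    simp
  have hbd : ∀ ω ∈ G, ∀ s t, |∫ r in s..t, φ (τ r ω)| ≤ C * |t - s| := by
    intro ω hω s t
    rw [← Real.norm_eq_abs]
    exact intervalIntegral.norm_integral_le_of_norm_le_const fun r _ => hGb ω hω r
  let B : Set Ω := {ω | ω ∈ G ∧ ∃ N : ℕ, ∀ m : ℕ, -(N : ℝ) ≤ ∫ r in (0:ℝ)..m, φ (τ r ω)}
  have hB : MeasurableSet B := by
    refine hG.inter ?_
    have h1 : ∀ m : ℕ, Measurable fun ω => ∫ r in (0:ℝ)..m, φ (τ r ω) := fun m =>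
      (measurable_intervalIntegral_uncurry (f := fun r ω => φ (τ r ω)) hjm 0).comp
        (measurable_const.prodMk measurable_id)
    have h2 : {ω | ∃ N : ℕ, ∀ m : ℕ, -(N : ℝ) ≤ ∫ r in (0:ℝ)..m, φ (τ r ω)} =
        ⋃ N : ℕ, ⋂ m : ℕ, {ω | -(N : ℝ) ≤ ∫ r in (0:ℝ)..m, φ (τ r ω)} := by
      ext ω; simp
    change MeasurableSet {ω | ∃ N : ℕ, ∀ m : ℕ, -(N : ℝ) ≤ ∫ r in (0:ℝ)..m, φ (τ r ω)}
    exact h2 ▸ MeasurableSet.iUnion fun N => MeasurableSet.iInter fun m =>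
      measurableSet_le measurable_const (h1 m)
  have hBinv : ∀ x ω, ω ∈ B → τ x ω ∈ B := by
    rintro z ω ⟨hω, N, hN⟩
    refine ⟨(hGinv z ω).2 hω, ?_⟩
    obtain ⟨N', hN'⟩ := exists_nat_ge (N + C * (2 * |z| + 1) + C * |z|)
    refine ⟨N', fun m => ?_⟩
    rw [hshift]
    obtain ⟨k, hk⟩ : ∃ k : ℕ, |(m : ℝ) + z - k| ≤ 2 * |z| + 1 := by
      refine ⟨⌈(m : ℝ) + |z|⌉₊, ?_⟩
      have h1 := Nat.le_ceil ((m : ℝ) + |z|)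
      have h2 := Nat.ceil_lt_add_one (a := (m : ℝ) + |z|) (by positivity)
      rw [abs_le]
      constructor <;> linarith [neg_abs_le z, le_abs_self z]
    have h3 : ∫ r in z..(m + z), φ (τ r ω) = (∫ r in z..0, φ (τ r ω)) +
        (∫ r in (0:ℝ)..k, φ (τ r ω)) + ∫ r in (k:ℝ)..(m + z), φ (τ r ω) := by
      rw [intervalIntegral.integral_add_adjacent_intervals (hI ω hω _ _) (hI ω hω _ _),
        intervalIntegral.integral_add_adjacent_intervals (hI ω hω _ _) (hI ω hω _ _)]
    have h4 := hbd ω hω z 0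
    have h5 := hbd ω hω k (m + z)
    have h6 : C * |(m:ℝ) + z - k| ≤ C * (2 * |z| + 1) := mul_le_mul_of_nonneg_left hk hC
    rw [zero_sub, abs_neg] at h4
    rw [h3]
    linarith [hN k, (abs_le.1 h4).1, (abs_le.1 h5).1]
  rcases hF.ae_mem_or_ae_notMem hB hBinv with h | h
  · exact h.mono fun ω h => h.2
  exfalso
  let ψ : Ω → ℝ := fun ω => -∫ r in (0:ℝ)..1, φ (τ r ω)
  have hψ : Measurable ψ :=
    ((measurable_intervalIntegral_uncurry (f := fun r ω => φ (τ r ω)) hjm 0).comp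
        (measurable_const.prodMk measurable_id)).neg
  have hψint : Integrable ψ P := by
    refine Integrable.of_bound hψ.aestronglyMeasurable C ?_
    filter_upwards [hGae] with ω hω
    simpa [ψ] using hbd ω hω 0 1
  have hsum : ∀ ω ∈ G, ∀ n, birkhoffSum (τ 1) ψ n ω = -∫ r in (0:ℝ)..n, φ (τ r ω) := by
    intro ω hω n
    have hit : ∀ n : ℕ, (τ 1)^[n] ω = τ n ω := by
      intro n
      induction n with
      | zero => simp [hF.zero]
      | succ n ih => rw [Function.iterate_succ_apply', ih, ← hF.add]; push_cast; rw [add_comm]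
    induction n with
    | zero => simp
    | succ n ih =>
      rw [birkhoffSum_succ, ih, hit]
      simp only [ψ]
      rw [hshift, ← intervalIntegral.integral_add_adjacent_intervals (hI ω hω 0 n)
        (hI ω hω n (n + 1 : ℕ))]
      push_cast
      rw [add_comm (1:ℝ)]
      ring
  have hex : ∀ᵐ ω ∂P, ∃ n, 0 < birkhoffSum (τ 1) ψ n ω := by
    filter_upwards [h, hGae] with ω hω hωG
    by_contra! hc
    refine hω ⟨hωG, 0, fun m => ?_⟩
    have := hc m
    rw [hsum ω hωG] at this
    simpa using this
  have h1 := integral_nonneg_of_ae_exists_birkhoffSum_pos (hF.mp 1) hψ hψint hex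
  have h2 : ∫ ω, ψ ω ∂P = -∫ ω, φ ω ∂P := by
    simp only [ψ, intervalIntegral.integral_of_le zero_le_one]
    rw [integral_neg, integral_integral_swap]
    · have h3 : ∀ r, ∫ ω, φ (τ r ω) ∂P = ∫ ω, φ ω ∂P := by
        intro r
        have := integral_map (hF.mp r).measurable.aemeasurable (μ := P) (f := φ)
          hφ.aestronglyMeasurable
        rw [(hF.mp r).map_eq] at this
        exact this.symm
      simp [h3]
    · refine Integrable.of_bound (hjm.comp measurable_swap).aestronglyMeasurable C ?_
      have h4 : ∀ᵐ q ∂(P.prod (volume.restrict (Ioc (0:ℝ) 1))), q.1 ∈ G :=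
        Measure.quasiMeasurePreserving_fst.ae hGae
      filter_upwards [h4] with q hq
      exact hGb _ hq _
  linarith

/-- Almost every forward orbit visits a set of measure larger than `1 - ρ` regularly. -/
lemma ae_visits (hF : IsErgodicFlow P τ) {B : Set Ω} (hB : MeasurableSet B) {ρ : ℝ} (hρ : 0 < ρ)
    (hρ1 : ρ ≤ 1) (hPB : 1 - ρ < P.real B) :
    ∀ᵐ ω ∂P, ∃ N : ℝ, ∀ y ≥ (0:ℝ), ∀ l ≥ (0:ℝ), (∀ r ∈ Icc y (y + l), τ r ω ∉ B) →
      (1 - ρ) * l ≤ ρ * y + N := by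
  have := hF.prob
  let φ : Ω → ℝ := fun ω => B.indicator (fun _ => (1:ℝ)) ω - (1 - ρ)
  have hφ : Measurable φ := (measurable_const.indicator hB).sub measurable_const
  have hind : ∀ ω, 0 ≤ B.indicator (fun _ => (1:ℝ)) ω ∧ B.indicator (fun _ => (1:ℝ)) ω ≤ 1 := by
    intro ω
    by_cases h : ω ∈ B <;> simp [h]
  have hb : ∀ ω, |φ ω| ≤ 1 := by
    intro ω
    rw [abs_le]
    constructor <;> simp only [φ] <;> linarith [(hind ω).1, (hind ω).2]
  have hpos : 0 < ∫ ω, φ ω ∂P := by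
    have h1 : ∫ ω, φ ω ∂P = P.real B - (1 - ρ) := by
      simp only [φ]
      rw [integral_sub ((integrable_const _).indicator hB) (integrable_const _),
        integral_indicator hB]
      simp
    rw [h1]; linarith
  filter_upwards [hF.ae_orbit_integral_bddBelow hφ (ae_of_all _ fun ω x => hb _) hpos]
    with ω ⟨N, hN⟩
  refine ⟨N + 1, fun y hy l hl hr => ?_⟩
  have hI := hF.intervalIntegrable_orbit hφ (ω := ω) fun x => hb _
  have h1 := integral_lower_bound_of_nat hI (fun r => hb (τ r ω)) hN (add_nonneg hy hl)
  rw [← intervalIntegral.integral_add_adjacent_intervals (hI 0 y) (hI y (y + l))] at h1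
  have h2 : ∫ r in y..(y + l), φ (τ r ω) = ∫ r in y..(y + l), -(1 - ρ) := by
    refine intervalIntegral.integral_congr fun r hr' => ?_
    rw [uIcc_of_le (by linarith)] at hr'
    simp [φ, hr r hr']
  have h3 : ∫ r in (0:ℝ)..y, φ (τ r ω) ≤ ∫ r in (0:ℝ)..y, ρ := by
    refine intervalIntegral.integral_mono_on hy (hI 0 y) intervalIntegrable_const fun r _ => ?_
    simp only [φ]
    linarith [(hind (τ r ω)).2]
  rw [h2] at h1
  simp only [intervalIntegral.integral_const, smul_eq_mul] at h1 h3
  nlinarith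

end IsErgodicFlow

section Gronwall

variable {h h' c : ℝ → ℝ}

lemma hasDerivAt_integral_of_continuous (hc : Continuous c) (s x : ℝ) :
    HasDerivAt (fun x => ∫ r in s..x, c r) (c x) x :=
  intervalIntegral.integral_hasDerivAt_right (hc.intervalIntegrable _ _)
    (hc.stronglyMeasurableAtFilter _ _) hc.continuousAt

lemma nonneg_of_neg_mul_abs_le_deriv (hc : Continuous c) (hh : ∀ x, HasDerivAt h (h' x) x)
    {x₁ : ℝ} (hge : ∀ x, x₁ ≤ x → -(c x * |h x|) ≤ h' x) (h1 : 0 ≤ h x₁) {x : ℝ} (hx : x₁ ≤ x) :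
    0 ≤ h x := by
  by_contra! hneg
  have hcont : Continuous h := continuous_iff_continuousAt.2 fun x => (hh x).continuousAt
  let S : Set ℝ := Icc x₁ x ∩ h ⁻¹' Ici 0
  have hScl : IsClosed S := isClosed_Icc.inter (isClosed_Ici.preimage hcont)
  have hSbdd : BddAbove S := ⟨x, fun y hy => hy.1.2⟩
  have hSne : S.Nonempty := ⟨x₁, ⟨le_rfl, hx⟩, h1⟩
  have hz : sSup S ∈ S := hScl.csSup_mem hSne hSbdd
  set z := sSup S with hzdef
  let E : ℝ → ℝ := fun y => h y * Real.exp (-∫ r in (0:ℝ)..y, c r)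
  have hE : ∀ y, HasDerivAt E ((h' y - c y * h y) * Real.exp (-∫ r in (0:ℝ)..y, c r)) y := by
    intro y
    have := (hh y).mul ((hasDerivAt_integral_of_continuous hc 0 y).neg.exp)
    exact this.congr_deriv (by simp only [Pi.neg_apply]; ring)
  have hmono : MonotoneOn E (Icc z x) := by
    refine monotoneOn_of_deriv_nonneg (convex_Icc _ _)
      (fun y _ => (hE y).continuousAt.continuousWithinAt)
      (fun y _ => (hE y).differentiableAt.differentiableWithinAt) fun y hy => ?_
    rw [interior_Icc] at hy
    rw [(hE y).deriv]
    have hy0 : h y < 0 := by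
      by_contra! hc0
      have : y ≤ z := le_csSup hSbdd ⟨⟨hz.1.1.trans hy.1.le, hy.2.le⟩, hc0⟩
      exact absurd hy.1 (not_lt.2 this)
    have := hge y (hz.1.1.trans hy.1.le)
    rw [abs_of_neg hy0] at this
    exact mul_nonneg (by linarith) (Real.exp_pos _).le
  have h2 := hmono ⟨le_rfl, hz.1.2⟩ ⟨hz.1.2, le_rfl⟩ hz.1.2
  have h3 : 0 ≤ E z := mul_nonneg hz.2 (Real.exp_pos _).le
  have h4 : E x < 0 := mul_neg_of_neg_of_pos hneg (Real.exp_pos _)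
  linarith

lemma pos_of_neg_mul_abs_le_deriv (hc : Continuous c) (hh : ∀ x, HasDerivAt h (h' x) x)
    {x₁ : ℝ} (hge : ∀ x, x₁ ≤ x → -(c x * |h x|) ≤ h' x) (h1 : 0 < h x₁) {x : ℝ} (hx : x₁ ≤ x) :
    0 < h x := by
  let E : ℝ → ℝ := fun y => h y * Real.exp (∫ r in (0:ℝ)..y, c r)
  have hE : ∀ y, HasDerivAt E ((h' y + c y * h y) * Real.exp (∫ r in (0:ℝ)..y, c r)) y := by
    intro y
    have := (hh y).mul ((hasDerivAt_integral_of_continuous hc 0 y).exp)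
    exact this.congr_deriv (by ring)
  have hmono : MonotoneOn E (Icc x₁ x) := by
    refine monotoneOn_of_deriv_nonneg (convex_Icc _ _)
      (fun y _ => (hE y).continuousAt.continuousWithinAt)
      (fun y _ => (hE y).differentiableAt.differentiableWithinAt) fun y hy => ?_
    rw [interior_Icc] at hy
    rw [(hE y).deriv]
    have hy0 := nonneg_of_neg_mul_abs_le_deriv hc hh hge h1.le hy.1.le
    have := hge y hy.1.le
    rw [abs_of_nonneg hy0] at this
    exact mul_nonneg (by linarith) (Real.exp_pos _).le
  have h2 := hmono ⟨le_rfl, hx⟩ ⟨hx, le_rfl⟩ hx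
  have h3 : 0 < E x₁ := mul_pos h1 (Real.exp_pos _)
  exact pos_of_mul_pos_left (h3.trans_le h2) (Real.exp_pos _).le

lemma pos_of_abs_deriv_le (hc : Continuous c) (hh : ∀ x, HasDerivAt h (h' x) x)
    (hle : ∀ x, |h' x| ≤ c x * |h x|) {x₁ : ℝ} (h1 : 0 < h x₁) (x : ℝ) : 0 < h x := by
  rcases le_total x₁ x with hx | hx
  · exact pos_of_neg_mul_abs_le_deriv hc hh (fun y _ => (abs_le.1 (hle y)).1) h1 hx
  · have := pos_of_neg_mul_abs_le_deriv (h := fun y => h (-y)) (h' := fun y => -h' (-y))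
      (c := fun y => c (-y)) (x₁ := -x₁) (x := -x) (hc.comp continuous_neg)
      (fun y => by simpa [Function.comp_def] using (hh (-y)).scomp y (hasDerivAt_neg y))
      (fun y _ => by linarith [(abs_le.1 (hle (-y))).2]) (by simpa using h1) (by linarith)
    simpa using this

end Gronwall

/-- A function that is uniformly continuous has a linear modulus at large scale. -/
lemma exists_coarse_lipschitz {v : ℝ → ℝ → ℝ}
    (hv : UniformContinuousOn (fun q : ℝ × ℝ => v q.1 q.2) {q : ℝ × ℝ | 0 ≤ q.1}) :
    ∃ L > (0:ℝ), (∀ t ≥ (0:ℝ), ∀ x y, |v t x - v t y| ≤ 1 + L * |x - y|) ∧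
      ∀ t ≥ (0:ℝ), ∀ x, |v t x - v 0 x| ≤ 1 + L * t := by
  obtain ⟨d, hd, h⟩ := Metric.uniformContinuousOn_iff.1 hv 1 one_pos
  have key : ∀ (p q : ℝ × ℝ), 0 ≤ p.1 → 0 ≤ q.1 →
      |v p.1 p.2 - v q.1 q.2| ≤ 1 + (2 / d) * dist p q := by
    intro p q hp hq
    obtain ⟨n, hn1, hn2⟩ : ∃ n : ℕ, dist p q < n * d ∧ (n : ℝ) ≤ 1 + (2 / d) * dist p q := by
      refine ⟨⌊dist p q / d⌋₊ + 1, ?_, ?_⟩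
      · have := Nat.lt_floor_add_one (dist p q / d)
        rw [div_lt_iff₀ hd] at this
        exact_mod_cast this
      · have := Nat.floor_le (div_nonneg (dist_nonneg (x := p) (y := q)) hd.le)
        push_cast
        have h2 : 0 ≤ dist p q / d := by positivity
        have h3 : 2 / d * dist p q = 2 * (dist p q / d) := by ring
        linarith
    have hn0 : 0 < n := by
      rcases Nat.eq_zero_or_pos n with h0 | h0
      · subst h0
        simp at hn1
        linarith [dist_nonneg (x := p) (y := q)]
      · exact h0
    have hnR : (0:ℝ) < n := by exact_mod_cast hn0
    have hstep : ∀ k : ℕ, k ≤ n →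
        |v (p.1 + (k / n : ℝ) * (q.1 - p.1)) (p.2 + (k / n : ℝ) * (q.2 - p.2)) - v p.1 p.2| ≤ k := by
      intro k
      induction k with
      | zero => simp
      | succ k ih =>
        intro hk
        have ih := ih (by omega)
        have hpt : ∀ j : ℕ, j ≤ n → 0 ≤ p.1 + (j / n : ℝ) * (q.1 - p.1) := by
          intro j hj
          have h1 : (j / n : ℝ) ≤ 1 := (div_le_one hnR).2 (by exact_mod_cast hj)
          have h0 : (0:ℝ) ≤ j / n := by positivity
          nlinarith
        have hdist : dist (p.1 + ((k + 1 : ℕ) / n : ℝ) * (q.1 - p.1),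
            p.2 + ((k + 1 : ℕ) / n : ℝ) * (q.2 - p.2))
            (p.1 + (k / n : ℝ) * (q.1 - p.1), p.2 + (k / n : ℝ) * (q.2 - p.2)) < d := by
          have hdp : dist p q / n < d := by rw [div_lt_iff₀ hnR]; linarith
          refine lt_of_le_of_lt ?_ hdp
          have e1 : ∀ a b : ℝ, dist (a + ((k + 1 : ℕ) / n : ℝ) * (b - a)) (a + (k / n : ℝ) * (b - a))
              = |a - b| / n := by
            intro a b
            rw [Real.dist_eq]
            have : a + ((k + 1 : ℕ) / n : ℝ) * (b - a) - (a + (k / n : ℝ) * (b - a)) =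
              (b - a) / n := by push_cast; ring
            rw [this, abs_div, abs_of_pos hnR, abs_sub_comm]
          rw [Prod.dist_eq, e1, e1]
          refine max_le ?_ ?_ <;> refine div_le_div_of_nonneg_right ?_ hnR.le
          · rw [← Real.dist_eq]; exact le_max_left _ _
          · rw [← Real.dist_eq]; exact le_max_right _ _
        have h1 := h _ (hpt (k + 1) hk) _ (hpt k (by omega)) hdist
        rw [Real.dist_eq] at h1
        have := abs_sub_le (v (p.1 + ((k + 1 : ℕ) / n : ℝ) * (q.1 - p.1))
          (p.2 + ((k + 1 : ℕ) / n : ℝ) * (q.2 - p.2)))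
          (v (p.1 + (k / n : ℝ) * (q.1 - p.1)) (p.2 + (k / n : ℝ) * (q.2 - p.2))) (v p.1 p.2)
        push_cast at *
        linarith
    have := hstep n le_rfl
    rw [div_self hnR.ne', one_mul, one_mul, add_sub_cancel, add_sub_cancel, abs_sub_comm] at this
    linarith
  refine ⟨2 / d, by positivity, fun t ht x y => ?_, fun t ht x => ?_⟩
  · simpa [Prod.dist_eq, Real.dist_eq] using key (t, x) (t, y) ht ht
  · simpa [Prod.dist_eq, Real.dist_eq, abs_of_nonneg ht, max_eq_left ht] using key (t, x) (0, x) ht le_rfl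

/-- Comparison of a uniformly continuous subsolution with the stationary-in-time supersolution
`Λ t + ∫ g`. -/
lemma IsViscositySubsolution.le_of_barrier {alpha : ℝ → ℝ} {h : ℝ → ℝ → ℝ} {v : ℝ → ℝ → ℝ}
    (hv : IsViscositySubsolution alpha h v)
    (huc : UniformContinuousOn (fun q : ℝ × ℝ => v q.1 q.2) {q : ℝ × ℝ | 0 ≤ q.1})
    {θ : ℝ} (hinit : ∀ x, v 0 x = θ * x) {g : ℝ → ℝ} (hg : ContDiff ℝ 1 g) {Λ : ℝ}
    (hsup : ∀ x, alpha x * deriv g x + h (g x) x ≤ Λ) {y c C : ℝ} (hc : 0 < c)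
    (hgrow : ∀ x, θ * (x - y) + c * |x - y| - C ≤ ∫ r in y..x, g r) {t : ℝ} (ht : 0 ≤ t) :
    v t y ≤ θ * y + C + Λ * t := by
  obtain ⟨L, hL, -, hvt⟩ := exists_coarse_lipschitz huc
  let G : ℝ → ℝ := fun x => ∫ r in y..x, g r
  have hGd : ∀ x, HasDerivAt G (g x) x := hasDerivAt_integral_of_continuous hg.continuous y
  have hGderiv : deriv G = g := funext fun x => (hGd x).deriv
  have hG : ContDiff ℝ 2 G := by
    rw [show (2 : WithTop ℕ∞) = 1 + 1 from by norm_num, contDiff_succ_iff_deriv]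
    refine ⟨fun x => (hGd x).differentiableAt, by simp, by rwa [hGderiv]⟩
  have hGy : G y = 0 := intervalIntegral.integral_same
  have hC : 0 ≤ C := by
    have := hgrow y
    simp at this
    exact this
  have main : ∀ η > 0, v t y ≤ θ * y + C + Λ * t + η * t ^ 2 := by
    intro η hη
    let φ : ℝ × ℝ → ℝ := fun q => G q.2 + Λ * q.1 + η * q.1 ^ 2
    have hφ : ContDiff ℝ 2 φ :=
      ((hG.comp contDiff_snd).add (contDiff_const.mul contDiff_fst)).add
        (contDiff_const.mul (contDiff_fst.pow 2))
    let W : ℝ × ℝ → ℝ := fun q => v q.1 q.2 - φ q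
    have hWcont : ContinuousOn W {q : ℝ × ℝ | 0 ≤ q.1} :=
      huc.continuousOn.sub hφ.continuous.continuousOn
    have hWle : ∀ q : ℝ × ℝ, 0 ≤ q.1 →
        W q ≤ θ * y + C + 1 + (L + |Λ|) * q.1 - η * q.1 ^ 2 - c * |q.2 - y| := by
      intro q hq
      have h1 := (abs_le.1 (hvt q.1 hq q.2)).2
      have h2 := hgrow q.2
      have h3 : -Λ * q.1 ≤ |Λ| * q.1 := mul_le_mul_of_nonneg_right (neg_le_abs Λ) hq
      rw [hinit] at h1
      simp only [W, φ, G]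
      linarith
    -- the maximum over a large box is a global maximum
    let T : ℝ := (L + |Λ| + C + 2) / η + 1
    let X : ℝ := (C + 1 + (L + |Λ|) * T) / c
    have hLam := abs_nonneg Λ
    have hT : 0 < T := by positivity
    have hX : 0 ≤ X := by positivity
    have hWy : W (0, y) = θ * y := by simp [W, φ, hinit, hGy]
    let K : Set (ℝ × ℝ) := Icc 0 T ×ˢ Icc (y - X) (y + X)
    have hK : IsCompact K := isCompact_Icc.prod isCompact_Icc
    have hyK : ((0:ℝ), y) ∈ K := ⟨⟨le_rfl, hT.le⟩, by linarith, by linarith⟩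
    obtain ⟨q₀, hq₀, hmax⟩ := hK.exists_isMaxOn ⟨_, hyK⟩
      (hWcont.mono fun q hq => hq.1.1)
    have hglob : ∀ q : ℝ × ℝ, 0 ≤ q.1 → W q ≤ W q₀ := by
      intro q hq
      by_cases hqK : q ∈ K
      · exact hmax hqK
      refine le_trans ?_ (hmax hyK)
      rw [hWy]
      have hηT : η * T = L + |Λ| + C + 2 + η := by
        simp only [T]; field_simp
      have hcX : c * X = C + 1 + (L + |Λ|) * T := by
        simp only [X]; field_simp
      have h0 := hWle q hq
      rcases le_total q.1 T with hqT | hqT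
      · have hx : X ≤ |q.2 - y| := by
          by_contra! hlt
          rw [abs_lt] at hlt
          exact hqK ⟨⟨hq, hqT⟩, by linarith [hlt.1], by linarith [hlt.2]⟩
        have h1 : c * X ≤ c * |q.2 - y| := mul_le_mul_of_nonneg_left hx hc.le
        have h2 : (L + |Λ|) * q.1 ≤ (L + |Λ|) * T := mul_le_mul_of_nonneg_left hqT (by positivity)
        nlinarith [sq_nonneg q.1]
      · have h1 : 0 ≤ c * |q.2 - y| := by positivity
        have hT1 : 1 ≤ T := by
          have : 0 ≤ (L + |Λ| + C + 2) / η := by positivity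
          simp only [T]; linarith
        have h2 : η * T * q.1 ≤ η * q.1 ^ 2 := by
          rw [sq, ← mul_assoc]
          exact mul_le_mul_of_nonneg_right (mul_le_mul_of_nonneg_left hqT hη.le) hq
        rw [hηT] at h2
        nlinarith
    have hq₀0 : 0 ≤ q₀.1 := hq₀.1.1
    have hW0 : W q₀ ≤ θ * y + C := by
      rcases hq₀0.eq_or_lt with h0 | hpos
      · have h2 := hgrow q₀.2
        have : 0 ≤ c * |q₀.2 - y| := by positivity
        simp only [W, φ, G, ← h0, hinit]
        linarith
      · exfalso
        have hloc : IsLocalMax (fun q : ℝ × ℝ => v q.1 q.2 - φ q) (q₀.1, q₀.2) := by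
          filter_upwards [(isOpen_lt continuous_const continuous_fst).mem_nhds hpos] with q hq
          exact hglob q (le_of_lt hq)
        have := hv q₀.1 q₀.2 hpos φ hφ.contDiffOn hloc
        have e1 : deriv (fun t => φ (t, q₀.2)) q₀.1 = Λ + 2 * η * q₀.1 := by
          have : HasDerivAt (fun t => φ (t, q₀.2)) (0 + Λ * 1 + η * (2 * q₀.1)) q₀.1 := by
            exact ((hasDerivAt_const q₀.1 (G q₀.2)).add ((hasDerivAt_id q₀.1).const_mul Λ)).add
              (((hasDerivAt_pow 2 q₀.1).congr_deriv (by simp)).const_mul η)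
          rw [this.deriv]; ring
        have e2 : (deriv fun x => φ (q₀.1, x)) = g := by
          funext x
          have : HasDerivAt (fun x => φ (q₀.1, x)) (g x) x :=
            ((hGd x).add_const (Λ * q₀.1)).add_const (η * q₀.1 ^ 2)
          exact this.deriv
        have e3 : deriv (fun x => φ (q₀.1, x)) q₀.2 = g q₀.2 := congrFun e2 _
        rw [e1, e2] at this
        have := hsup q₀.2
        nlinarith
    have := (hglob (t, y) ht).trans hW0
    simp only [W, φ, hGy] at this
    linarith
  refine le_of_forall_pos_le_add fun ε hε => ?_
  have h1 := main (ε / (t ^ 2 + 1)) (by positivity)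
  have h2 : ε / (t ^ 2 + 1) * t ^ 2 ≤ ε := by
    rw [div_mul_eq_mul_div, div_le_iff₀ (by positivity)]
    nlinarith
  linarith

lemma hasDerivAt_of_tendsto_of_eq_integral {z F : ℕ → ℝ → ℝ} {Z b : ℝ → ℝ} {Θ : ℝ → ℝ → ℝ} {s : ℝ}
    (hΘ : Continuous fun q : ℝ × ℝ => Θ q.1 q.2) (hF : ∀ k, Continuous (F k)) (hb : Continuous b)
    (hFb : ∀ k x, |F k x| ≤ b x) (hz : ∀ k x, z k x = z k s + ∫ r in s..x, F k r)
    (hZ : ∀ x, Tendsto (fun k => z k x) atTop (nhds (Z x)))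
    (hlim : ∀ x, Tendsto (fun k => F k x) atTop (nhds (Θ (Z x) x))) (x : ℝ) :
    HasDerivAt Z (Θ (Z x) x) x := by
  have hmeas : Measurable fun r => Θ (Z r) r :=
    measurable_of_tendsto_metrizable (fun k => (hF k).measurable) (tendsto_pi_nhds.2 hlim)
  have hbd : ∀ r, |Θ (Z r) r| ≤ b r := fun r =>
    le_of_tendsto (hlim r).abs (Eventually.of_forall fun k => hFb k r)
  have hint : ∀ u v, IntervalIntegrable (fun r => Θ (Z r) r) volume u v := fun u v =>
    (hb.intervalIntegrable u v).mono_fun hmeas.aestronglyMeasurable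
      (ae_of_all _ fun r => (hbd r).trans (le_abs_self _))
  have heq : ∀ x, Z x = Z s + ∫ r in s..x, Θ (Z r) r := by
    intro x
    refine tendsto_nhds_unique (hZ x) ?_
    simp_rw [fun k => hz k x]
    refine (hZ s).add ?_
    exact intervalIntegral.tendsto_integral_filter_of_dominated_convergence b
      (Eventually.of_forall fun k => (hF k).aestronglyMeasurable)
      (Eventually.of_forall fun k => ae_of_all _ fun r _ => hFb k r)
      (hb.intervalIntegrable _ _) (ae_of_all _ fun r _ => hlim r)
  have hZc : Continuous Z := by
    rw [show Z = fun x => Z s + ∫ r in s..x, Θ (Z r) r from funext heq]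
    exact continuous_const.add (intervalIntegral.continuous_primitive hint s)
  have hc : Continuous fun r => Θ (Z r) r := hΘ.comp (hZc.prodMk continuous_id)
  have := (hasDerivAt_integral_of_continuous hc s x).const_add (Z s)
  exact this.congr_of_eventuallyEq (Eventually.of_forall heq)

/-- Solution, measurable in a parameter, of an ODE with nonnegative monotone right-hand side. -/
lemma exists_measurable_solution {Ω : Type} [MeasurableSpace Ω] {Θ : ℝ → ℝ → Ω → ℝ}
    (hΘm : Measurable fun q : (ℝ × ℝ) × Ω => Θ q.1.1 q.1.2 q.2) {b : ℝ → Ω → ℝ} {G : Set Ω} (s : ℝ)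
    (hcont : ∀ ω ∈ G, Continuous fun q : ℝ × ℝ => Θ q.1 q.2 ω)
    (hmono : ∀ ω ∈ G, ∀ x, Monotone fun y => Θ y x ω)
    (hnn : ∀ ω ∈ G, ∀ y x, 0 ≤ Θ y x ω) (hb : ∀ ω ∈ G, ∀ y x, Θ y x ω ≤ b x ω)
    (hbc : ∀ ω ∈ G, Continuous fun x => b x ω) (h0 : ∀ ω ∈ G, ∀ x ≤ s, Θ 0 x ω = 0) :
    ∃ Y : ℝ → Ω → ℝ, (Measurable fun q : ℝ × Ω => Y q.1 q.2) ∧ ∀ ω ∈ G,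
      (∀ x, HasDerivAt (fun x => Y x ω) (Θ (Y x ω) x ω) x) ∧ ∀ x ≤ s, Y x ω = 0 := by
  let y : ℕ → ℝ → Ω → ℝ := fun k =>
    Nat.rec (fun _ _ => 0) (fun _ w x ω => ∫ r in s..x, Θ (w r ω) r ω) k
  have hy0 : y 0 = fun _ _ => 0 := rfl
  have hys : ∀ k, y (k + 1) = fun x ω => ∫ r in s..x, Θ (y k r ω) r ω := fun k => rfl
  have hym : ∀ k, Measurable fun q : ℝ × Ω => y k q.1 q.2 := by
    intro k
    induction k with
    | zero => exact measurable_const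
    | succ k ih =>
      exact measurable_intervalIntegral_uncurry (f := fun r ω => Θ (y k r ω) r ω)
        (hΘm.comp ((ih.prodMk measurable_fst).prodMk measurable_snd)) s
  refine ⟨fun x ω => ⨆ k, y k x ω, Measurable.iSup fun k => hym k, fun ω hω => ?_⟩
  have hyc : ∀ k, Continuous fun x => y k x ω := by
    intro k
    induction k with
    | zero => exact continuous_const
    | succ k ih =>
      have : Continuous fun r => Θ (y k r ω) r ω := (hcont ω hω).comp (ih.prodMk continuous_id)
      exact continuous_iff_continuousAt.2 fun x =>
        (hasDerivAt_integral_of_continuous this s x).continuousAt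
  have hFc : ∀ k, Continuous fun r => Θ (y k r ω) r ω := fun k =>
    (hcont ω hω).comp ((hyc k).prodMk continuous_id)
  have hyz : ∀ k, ∀ x ≤ s, y k x ω = 0 := by
    intro k
    induction k with
    | zero => intro x _; rfl
    | succ k ih =>
      intro x hx
      rw [hys]
      refine intervalIntegral.integral_zero_ae (ae_of_all _ fun r hr => ?_)
      rw [uIoc_of_ge hx] at hr
      rw [ih r hr.2, h0 ω hω r hr.2]
  have hstep : ∀ k, ∀ x, y k x ω ≤ y (k + 1) x ω := by
    intro k x
    rcases le_total x s with hx | hx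
    · rw [hyz k x hx, hyz (k + 1) x hx]
    induction k generalizing x with
    | zero =>
      rw [hys]
      exact intervalIntegral.integral_nonneg hx fun r _ => hnn ω hω _ _
    | succ k ih =>
      rw [hys, hys (k + 1)]
      refine intervalIntegral.integral_mono_on hx ((hFc k).intervalIntegrable _ _)
        ((hFc (k + 1)).intervalIntegrable _ _) fun r hr => ?_
      exact hmono ω hω r (ih r hr.1)
  have hymono : ∀ x, Monotone fun k => y k x ω := fun x =>
    monotone_nat_of_le_succ fun k => hstep k x
  have hbdd : ∀ x, BddAbove (range fun k => y k x ω) := by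
    intro x
    refine ⟨max 0 (∫ r in s..x, b r ω), ?_⟩
    rintro _ ⟨k, rfl⟩
    rcases le_total x s with hx | hx
    · simp only [hyz k x hx]; exact le_max_left _ _
    · cases k with
      | zero => exact le_max_left _ _
      | succ k =>
        refine le_max_of_le_right ?_
        simp only [hys]
        exact intervalIntegral.integral_mono_on hx ((hFc k).intervalIntegrable _ _)
          ((hbc ω hω).intervalIntegrable _ _) fun r _ => hb ω hω _ _
  have hlim : ∀ x, Tendsto (fun k => y k x ω) atTop (nhds (⨆ k, y k x ω)) := fun x =>
    tendsto_atTop_ciSup (hymono x) (hbdd x)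
  constructor
  · refine hasDerivAt_of_tendsto_of_eq_integral (z := fun k x => y (k + 1) x ω)
      (F := fun k r => Θ (y k r ω) r ω) (Θ := fun y x => Θ y x ω) (s := s)
      (hcont ω hω) hFc (hbc ω hω) ?_ ?_ ?_ ?_
    · intro k x
      rw [abs_of_nonneg (hnn ω hω _ _)]
      exact hb ω hω _ _
    · intro k x
      simp only [hyz (k + 1) s le_rfl, zero_add]
      rfl
    · exact fun x => (tendsto_add_atTop_iff_nat 1).2 (hlim x)
    · intro x
      exact (((hcont ω hω).comp (continuous_id.prodMk continuous_const)).tendsto _).comp (hlim x)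
  · intro x hx
    simp [hyz _ x hx]

/-- The part of the standing assumptions that is invariant under `H(p,x,ω) ↦ -H(-p,x,ω)`. -/
structure IsEnvironment {Ω : Type} [MeasurableSpace Ω] (P : Measure Ω) (τ : ℝ → Ω → Ω)
    (a : ℝ → Ω → ℝ) (H : ℝ → ℝ → Ω → ℝ) : Prop where
  flow : IsErgodicFlow P τ
  meas_a : Measurable fun q : ℝ × Ω => a q.1 q.2
  a_pos : ∀ x ω, 0 < a x ω
  a_stat : ∀ x ω, a x ω = a 0 (τ x ω)
  a_cont : ∀ ω, Continuous fun x => a x ω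
  meas_H : Measurable fun q : ℝ × ℝ × Ω => H q.1 q.2.1 q.2.2
  H_stat : ∀ p x ω, H p x ω = H p 0 (τ x ω)
  H_lip : ∀ R > (0:ℝ), ∃ K > (0:ℝ), ∀ p q x ω, |p| ≤ R → |q| ≤ R →
      |H p x ω - H q x ω| ≤ K * |p - q|
  H_cont : ∀ ω, Continuous fun q : ℝ × ℝ => H q.1 q.2 ω

section Setting

variable {Ω : Type} [MeasurableSpace Ω] {P : Measure Ω} {τ : ℝ → Ω → Ω}
  {a : ℝ → Ω → ℝ} {H : ℝ → ℝ → Ω → ℝ}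

lemma HJSetting.isEnvironment {G_L G_U : ℝ → ℝ} (h : HJSetting P τ a H G_L G_U) :
    IsEnvironment P τ a H where
  flow := ⟨h.prob, h.meas_tau, h.mp_tau, h.tau_zero, h.tau_add, h.ergodic⟩
  meas_a := h.meas_a
  a_pos := h.a_pos
  a_stat := h.a_stat
  a_cont ω := by
    obtain ⟨κ, hκ, hl⟩ := h.a_sqrt_lip
    have hL : LipschitzWith κ.toNNReal fun x => Real.sqrt (a x ω) := by
      refine LipschitzWith.of_dist_le_mul fun x y => ?_
      rw [Real.dist_eq, Real.dist_eq, Real.coe_toNNReal _ hκ.le]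
      have := hl (x - y) (τ y ω)
      rwa [h.a_stat (x - y), ← h.tau_add, sub_add_cancel, ← h.a_stat, ← h.a_stat] at this
    have : (fun x => a x ω) = fun x => Real.sqrt (a x ω) ^ 2 :=
      funext fun x => (Real.sq_sqrt (h.a_pos x ω).le).symm
    rw [this]
    exact hL.continuous.pow 2
  meas_H := h.meas_H
  H_stat := h.H_stat
  H_lip R hR := by
    obtain ⟨K, hK, hl⟩ := h.H_lip R hR
    refine ⟨K, hK, fun p q x ω hp hq => ?_⟩
    rw [h.H_stat p, h.H_stat q]
    exact hl p q _ hp hq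
  H_cont ω := by
    rw [continuous_iff_continuousAt]
    rintro ⟨p, x⟩
    obtain ⟨K, hK, hl⟩ := h.H_lip (|p| + 1) (by positivity)
    obtain ⟨m, hm0, -, hm, hmod⟩ := h.H_mod (|p| + 1) (by positivity)
    have hcx : Tendsto (fun y => H p y ω) (nhds x) (nhds (H p x ω)) := by
      rw [tendsto_iff_dist_tendsto_zero]
      have h1 : Tendsto (fun r => max (m r) 0 * if r = 0 then 0 else 1) (nhdsWithin 0 (Ici 0))
          (nhds (0:ℝ)) := by
        rw [← Ioi_insert, nhdsWithin_insert, tendsto_sup]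
        constructor
        · rw [tendsto_pure_left]
          intro s hs
          simpa using mem_of_mem_nhds hs
        · refine Tendsto.congr' ?_ hm
          filter_upwards [self_mem_nhdsWithin] with r hr
          simp [(show (0:ℝ) < r from hr).ne', hm0 r]
      have h2 : Tendsto (fun y => |y - x|) (nhds x) (nhdsWithin 0 (Ici 0)) := by
        refine tendsto_nhdsWithin_iff.2 ⟨?_, Eventually.of_forall fun y => mem_Ici.2 (abs_nonneg _)⟩
        have : Continuous fun y : ℝ => |y - x| := by fun_prop
        simpa using this.tendsto x
      refine squeeze_zero (fun _ => dist_nonneg) (fun y => ?_) (h1.comp h2)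
      by_cases hy : y = x
      · simp [hy]
      · have := hmod p (y - x) (τ x ω) (by linarith)
        rw [h.H_stat p (y - x), ← h.tau_add, sub_add_cancel, ← h.H_stat, ← h.H_stat] at this
        rw [Real.dist_eq]
        simpa [sub_ne_zero.2 hy, hm0] using this
    have hsum : Tendsto (fun q : ℝ × ℝ => (H q.1 q.2 ω - H p q.2 ω) + H p q.2 ω) (nhds (p, x))
        (nhds (0 + H p x ω)) := by
      refine Tendsto.add ?_ (hcx.comp (continuous_snd.tendsto (p, x)))
      rw [tendsto_zero_iff_abs_tendsto_zero]
      have h3 : Tendsto (fun q : ℝ × ℝ => K * |q.1 - p|) (nhds (p, x)) (nhds 0) := by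
        have : Continuous fun q : ℝ × ℝ => K * |q.1 - p| := by fun_prop
        simpa using this.tendsto (p, x)
      refine squeeze_zero' (Eventually.of_forall fun _ => abs_nonneg _) ?_ h3
      have : ∀ᶠ q : ℝ × ℝ in nhds (p, x), |q.1| < |p| + 1 := by
        have : Continuous fun q : ℝ × ℝ => |q.1| := by fun_prop
        exact (this.tendsto (p, x)).eventually_lt_const (by simp)
      filter_upwards [this] with q hq
      change |H q.1 q.2 ω - H p q.2 ω| ≤ _
      rw [h.H_stat q.1, h.H_stat p]
      exact hl _ _ _ hq.le (by linarith)
    simpa [ContinuousAt] using hsum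

lemma IsEnvironment.reflect (h : IsEnvironment P τ a H) :
    IsEnvironment P τ a fun p x ω => -H (-p) x ω where
  flow := h.flow
  meas_a := h.meas_a
  a_pos := h.a_pos
  a_stat := h.a_stat
  a_cont := h.a_cont
  meas_H := (h.meas_H.comp ((measurable_fst.neg).prodMk measurable_snd)).neg
  H_stat p x ω := by rw [h.H_stat]
  H_lip R hR := by
    obtain ⟨K, hK, hl⟩ := h.H_lip R hR
    refine ⟨K, hK, fun p q x ω hp hq => ?_⟩
    have := hl (-p) (-q) x ω (by simpa) (by simpa)
    rw [neg_sub_neg, abs_sub_comm, abs_sub_comm p]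
    rwa [neg_sub_neg] at this
  H_cont ω := ((h.H_cont ω).comp (by fun_prop : Continuous fun q : ℝ × ℝ => (-q.1, q.2))).neg

lemma StatSol.reflect {lam : ℝ} {f : ℝ → Ω → ℝ} (h : StatSol P τ a H lam f) :
    StatSol P τ a (fun p x ω => -H (-p) x ω) (-lam) fun x ω => -f x ω := by
  obtain ⟨h1, h2, h3, h4⟩ := h
  refine ⟨h1.neg, fun x ω => congrArg _ (h2 x ω), fun ω => (h3 ω).neg, ?_⟩
  filter_upwards [h4] with ω hω
  refine ⟨by simpa using hω.1, fun x => ?_⟩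
  rw [deriv.fun_neg, ← hω.2 x, neg_neg]
  ring

lemma Eset_reflect {θ : ℝ} (h : θ ∈ Eset P τ a fun p x ω => -H (-p) x ω) :
    -θ ∈ Eset P τ a H := by
  obtain ⟨lam, f, hf, rfl⟩ := h
  refine ⟨-lam, fun x ω => -f x ω, ?_, integral_neg _⟩
  have := hf.reflect
  simpa using this

/-- Two strictly ordered uniformly bounded stationary solutions on an invariant set of full
measure. -/
structure IsCorridor (P : Measure Ω) (τ : ℝ → Ω → Ω) (a : ℝ → Ω → ℝ) (H : ℝ → ℝ → Ω → ℝ)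
    (lam : ℝ) (f₁ f₂ : ℝ → Ω → ℝ) (G : Set Ω) (R₀ : ℝ) : Prop where
  env : IsEnvironment P τ a H
  measG : MeasurableSet G
  ae_mem : ∀ᵐ ω ∂P, ω ∈ G
  inv : ∀ x ω, τ x ω ∈ G ↔ ω ∈ G
  meas₁ : Measurable fun q : ℝ × Ω => f₁ q.1 q.2
  meas₂ : Measurable fun q : ℝ × Ω => f₂ q.1 q.2
  stat₁ : ∀ x ω, f₁ x ω = f₁ 0 (τ x ω)
  stat₂ : ∀ x ω, f₂ x ω = f₂ 0 (τ x ω)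
  pos : 0 < R₀
  bound₁ : ∀ ω ∈ G, ∀ x, |f₁ x ω| ≤ R₀
  bound₂ : ∀ ω ∈ G, ∀ x, |f₂ x ω| ≤ R₀
  ode₁ : ∀ ω ∈ G, ∀ x, HasDerivAt (fun y => f₁ y ω) ((lam - H (f₁ x ω) x ω) / a x ω) x
  ode₂ : ∀ ω ∈ G, ∀ x, HasDerivAt (fun y => f₂ y ω) ((lam - H (f₂ x ω) x ω) / a x ω) x
  lt : ∀ ω ∈ G, ∀ x, f₁ x ω < f₂ x ω

lemma StatSol.hasDerivAt (hE : IsEnvironment P τ a H) {lam : ℝ} {f : ℝ → Ω → ℝ}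
    (h : StatSol P τ a H lam f) {ω : Ω}
    (hω : ∀ x, a x ω * deriv (fun y => f y ω) x + H (f x ω) x ω = lam) (x : ℝ) :
    HasDerivAt (fun y => f y ω) ((lam - H (f x ω) x ω) / a x ω) x := by
  have h1 : deriv (fun y => f y ω) x = (lam - H (f x ω) x ω) / a x ω := by
    rw [eq_div_iff (hE.a_pos x ω).ne']
    linarith [hω x]
  rw [← h1]
  exact (((h.2.2.1 ω).differentiable one_ne_zero) x).hasDerivAt

lemma IsErgodicFlow.ae_bounded (hF : IsErgodicFlow P τ) {f : ℝ → Ω → ℝ}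
    (hm : Measurable fun q : ℝ × Ω => f q.1 q.2) (hs : ∀ x ω, f x ω = f 0 (τ x ω))
    (hc : ∀ ω, Continuous fun x => f x ω) (hb : ∀ᵐ ω ∂P, ∃ M, ∀ x, |f x ω| ≤ M) :
    ∃ n : ℕ, ∀ᵐ ω ∂P, ∀ x, |f x ω| ≤ n := by
  have := hF.prob
  by_contra hcon
  have hset : ∀ n : ℕ, ∀ᵐ ω ∂P, ω ∉ {ω | ∀ x, |f x ω| ≤ n} := by
    intro n
    have hms : MeasurableSet {ω | ∀ x, |f x ω| ≤ n} := by
      have : {ω | ∀ x, |f x ω| ≤ n} = ⋂ q : ℚ, {ω | |f q ω| ≤ n} := by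
        ext ω
        simp only [mem_ofPred_eq, mem_iInter]
        refine ⟨fun h q => h q, fun h x => ?_⟩
        have hcl : IsClosed {x | |f x ω| ≤ n} := isClosed_le (hc ω).abs continuous_const
        have hd : Dense (range ((↑) : ℚ → ℝ)) := Rat.denseRange_cast
        have := hcl.closure_subset_iff.2 (show range ((↑) : ℚ → ℝ) ⊆ _ by
          rintro _ ⟨q, rfl⟩; exact h q)
        exact this (hd x)
      rw [this]
      refine MeasurableSet.iInter fun q => measurableSet_le ?_ measurable_const
      exact (hm.comp (measurable_const.prodMk measurable_id)).abs
    refine (hF.ae_mem_or_ae_notMem hms fun x ω h y => ?_).resolve_left (not_exists.1 hcon n)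
    rw [hs, ← hF.add, ← hs]
    exact h _
  have : ∀ᵐ ω ∂P, False := by
    filter_upwards [hb, ae_all_iff.2 hset] with ω ⟨M, hM⟩ h2
    obtain ⟨n, hn⟩ := exists_nat_ge M
    exact h2 n fun x => (hM x).trans hn
  exact this.exists.elim fun _ h => h

lemma IsEnvironment.exists_isCorridor (hE : IsEnvironment P τ a H) {lam : ℝ} {f₁ f₂ : ℝ → Ω → ℝ}
    (hf₁ : StatSol P τ a H lam f₁) (hf₂ : StatSol P τ a H lam f₂)
    (hlt : (∫ ω, f₁ 0 ω ∂P) < ∫ ω, f₂ 0 ω ∂P) :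
    ∃ G R₀, IsCorridor P τ a H lam f₁ f₂ G R₀ := by
  have hF := hE.flow
  have := hF.prob
  obtain ⟨n₁, hn₁⟩ := hF.ae_bounded hf₁.1 hf₁.2.1 (fun ω => (hf₁.2.2.1 ω).continuous)
    (hf₁.2.2.2.mono fun _ h => h.1)
  obtain ⟨n₂, hn₂⟩ := hF.ae_bounded hf₂.1 hf₂.2.1 (fun ω => (hf₂.2.2.1 ω).continuous)
    (hf₂.2.2.2.mono fun _ h => h.1)
  set R₀ : ℝ := n₁ + n₂ + 1
  have hR₀ : 0 < R₀ := by positivity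
  have hsh : ∀ {f : ℝ → Ω → ℝ} (_ : ∀ x ω, f x ω = f 0 (τ x ω)) (x z : ℝ) (ω : Ω),
      f x (τ z ω) = f (x + z) ω := fun hs x z ω => by rw [hs, ← hF.add, ← hs]
  have haS := fun x z ω => hsh hE.a_stat x z ω
  have hHS : ∀ p x z ω, H p x (τ z ω) = H p (x + z) ω := fun p =>
    hsh (f := fun x ω => H p x ω) (hE.H_stat p)
  have key : ∀ {f : ℝ → Ω → ℝ} (_ : ∀ x ω, f x ω = f 0 (τ x ω)) (z : ℝ) (ω : Ω),
      (∀ x, HasDerivAt (fun y => f y ω) ((lam - H (f x ω) x ω) / a x ω) x) →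
      ∀ x, HasDerivAt (fun y => f y (τ z ω))
        ((lam - H (f x (τ z ω)) x (τ z ω)) / a x (τ z ω)) x := by
    intro f hs z ω h x
    simp_rw [hsh hs, haS, hHS]
    exact (h (x + z)).comp_add_const x z
  obtain ⟨G₀, hG₀, hG₀ae, hG₀inv, hG₀Q⟩ := hF.exists_invariant_set
    (Q := fun ω => (∀ x, |f₁ x ω| ≤ R₀) ∧ (∀ x, |f₂ x ω| ≤ R₀) ∧
      (∀ x, HasDerivAt (fun y => f₁ y ω) ((lam - H (f₁ x ω) x ω) / a x ω) x) ∧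
      ∀ x, HasDerivAt (fun y => f₂ y ω) ((lam - H (f₂ x ω) x ω) / a x ω) x) (by
        filter_upwards [hn₁, hn₂, hf₁.2.2.2, hf₂.2.2.2] with ω h1 h2 h3 h4
        refine ⟨fun x => (h1 x).trans ?_, fun x => (h2 x).trans ?_, hf₁.hasDerivAt hE h3.2,
          hf₂.hasDerivAt hE h4.2⟩ <;> simp only [R₀] <;>
        linarith [Nat.cast_nonneg (α := ℝ) n₁, Nat.cast_nonneg (α := ℝ) n₂])
    (by
      rintro z ω ⟨h1, h2, h3, h4⟩
      refine ⟨fun x => ?_, fun x => ?_, key hf₁.2.1 z ω h3, key hf₂.2.1 z ω h4⟩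
      · rw [hsh hf₁.2.1]; exact h1 _
      · rw [hsh hf₂.2.1]; exact h2 _)
  have hm₁ : Measurable (f₁ 0) := hf₁.1.comp (measurable_const.prodMk measurable_id)
  have hm₂ : Measurable (f₂ 0) := hf₂.1.comp (measurable_const.prodMk measurable_id)
  obtain ⟨K, hK, hl⟩ := hE.H_lip R₀ hR₀
  have hord : ∀ ω ∈ G₀, f₁ 0 ω < f₂ 0 ω → ∀ x, f₁ x ω < f₂ x ω := by
    intro ω hω h0 x
    obtain ⟨h1, h2, h3, h4⟩ := hG₀Q ω hω
    have := pos_of_abs_deriv_le (c := fun x => K / a x ω) (h := fun x => f₂ x ω - f₁ x ω)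
      (h' := fun x => (lam - H (f₂ x ω) x ω) / a x ω - (lam - H (f₁ x ω) x ω) / a x ω)
      (continuous_const.div (hE.a_cont ω) fun x => (hE.a_pos x ω).ne')
      (fun x => (h4 x).sub (h3 x)) (x₁ := 0) (fun x => ?_) (by simpa using h0) x
    · simpa using this
    · rw [← sub_div, abs_div, abs_of_pos (hE.a_pos x ω), div_mul_eq_mul_div]
      gcongr
      · exact (hE.a_pos x ω).le
      · have := hl (f₁ x ω) (f₂ x ω) x ω (h1 x) (h2 x)
        rw [abs_sub_comm (f₁ x ω)] at this
        rwa [show lam - H (f₂ x ω) x ω - (lam - H (f₁ x ω) x ω) = H (f₁ x ω) x ω - H (f₂ x ω) x ω by ring]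
  have hB : MeasurableSet (G₀ ∩ {ω | f₁ 0 ω < f₂ 0 ω}) :=
    hG₀.inter (measurableSet_lt hm₁ hm₂)
  have hor := hF.ae_mem_or_ae_notMem hB (by
    rintro x ω ⟨h1, h2⟩
    refine ⟨(hG₀inv x ω).2 h1, ?_⟩
    have := hord ω h1 h2 x
    rwa [hf₁.2.1 x, hf₂.2.1 x] at this)
  have hae : ∀ᵐ ω ∂P, ω ∈ G₀ ∩ {ω | f₁ 0 ω < f₂ 0 ω} := by
    refine hor.resolve_right fun hno => hlt.not_ge ?_
    refine integral_mono_ae ?_ ?_ ?_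
    · exact Integrable.of_bound hm₂.aestronglyMeasurable R₀
        (hG₀ae.mono fun ω h => (hG₀Q ω h).2.1 0)
    · exact Integrable.of_bound hm₁.aestronglyMeasurable R₀
        (hG₀ae.mono fun ω h => (hG₀Q ω h).1 0)
    · filter_upwards [hno, hG₀ae] with ω h1 h2
      exact not_lt.1 fun h3 => h1 ⟨h2, h3⟩
  obtain ⟨G, hG, hGae, hGinv, hGQ⟩ := hF.exists_invariant_set
    (Q := fun ω => ω ∈ G₀ ∧ ∀ x, f₁ x ω < f₂ x ω)
    (hae.mono fun ω h => ⟨h.1, hord ω h.1 h.2⟩) (by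
      rintro x ω ⟨h1, h2⟩
      refine ⟨(hG₀inv x ω).2 h1, fun y => ?_⟩
      rw [hsh hf₁.2.1, hsh hf₂.2.1]
      exact h2 _)
  exact ⟨G, R₀, hE, hG, hGae, hGinv, hf₁.1, hf₂.1, hf₁.2.1, hf₂.2.1, hR₀,
    fun ω h => (hG₀Q ω (hGQ ω h).1).1, fun ω h => (hG₀Q ω (hGQ ω h).1).2.1,
    fun ω h => (hG₀Q ω (hGQ ω h).1).2.2.1, fun ω h => (hG₀Q ω (hGQ ω h).1).2.2.2,
    fun ω h => (hGQ ω h).2⟩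

end Setting

/-- `r` clamped to `[0, b]`. -/
def ramp (b r : ℝ) : ℝ := max 0 (min r b)

lemma ramp_nonneg (b r : ℝ) : 0 ≤ ramp b r := le_max_left _ _

lemma ramp_le {b : ℝ} (hb : 0 ≤ b) (r : ℝ) : ramp b r ≤ b := max_le hb (min_le_right _ _)

lemma ramp_of_nonpos {b r : ℝ} (hr : r ≤ 0) : ramp b r = 0 :=
  max_eq_left ((min_le_left _ _).trans hr)

lemma ramp_of_mem {b r : ℝ} (h0 : 0 ≤ r) (hr : r ≤ b) : ramp b r = r := by
  rw [ramp, min_eq_left hr, max_eq_right h0]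

lemma ramp_of_ge {b r : ℝ} (hb : 0 ≤ b) (hr : b ≤ r) : ramp b r = b := by
  rw [ramp, min_eq_right hr, max_eq_right hb]

lemma ramp_mono (b : ℝ) : Monotone (ramp b) := fun _ _ h =>
  max_le_max le_rfl (min_le_min h le_rfl)

lemma abs_ramp_sub_le (b r t : ℝ) : |ramp b r - ramp b t| ≤ |r - t| :=
  (abs_max_sub_max_le_max _ _ _ _).trans <| by
    simpa using (abs_min_sub_min_le_max r b t b).trans (by simp)

/-- Truncated defect of the linearization with slope `K` of `H(·, x)` at `f₁ x`. -/
def excess (K : ℝ) (H : ℝ → ℝ → ℝ) (f₁ f₂ : ℝ → ℝ) (d x : ℝ) : ℝ :=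
  K * ramp (f₂ x - f₁ x) d - (H (f₁ x + ramp (f₂ x - f₁ x) d) x - H (f₁ x) x)

/-- A single path of the data: two ordered bounded solutions of `a f' + H(f, x) = lam`. -/
structure IsPathCorridor (a : ℝ → ℝ) (H : ℝ → ℝ → ℝ) (f₁ f₂ : ℝ → ℝ) (lam R₀ K : ℝ) : Prop where
  a_cont : Continuous a
  a_pos : ∀ x, 0 < a x
  H_cont : Continuous fun q : ℝ × ℝ => H q.1 q.2
  R₀_pos : 0 < R₀
  one_le : 1 ≤ K
  lip : ∀ p q x, |p| ≤ 5 * R₀ + 1 → |q| ≤ 5 * R₀ + 1 → |H p x - H q x| ≤ K * |p - q|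
  bound₁ : ∀ x, |f₁ x| ≤ R₀
  bound₂ : ∀ x, |f₂ x| ≤ R₀
  ode₁ : ∀ x, HasDerivAt f₁ ((lam - H (f₁ x) x) / a x) x
  ode₂ : ∀ x, HasDerivAt f₂ ((lam - H (f₂ x) x) / a x) x
  lt : ∀ x, f₁ x < f₂ x

/-- `d` solves the corrector equation for forcing `δ` switched on at `s`. -/
def IsCorrection (a : ℝ → ℝ) (H : ℝ → ℝ → ℝ) (f₁ f₂ : ℝ → ℝ) (K δ s : ℝ) (d : ℝ → ℝ) : Prop :=
  (∀ x, HasDerivAt d ((-K * d x + excess K H f₁ f₂ (d x) x + δ * ramp 1 (x - s)) / a x) x) ∧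
    ∀ x ≤ s, d x = 0

section Path

variable {a : ℝ → ℝ} {H : ℝ → ℝ → ℝ} {f₁ f₂ : ℝ → ℝ} {lam R₀ K δ s : ℝ} {d : ℝ → ℝ}

namespace IsPathCorridor

lemma K_pos (h : IsPathCorridor a H f₁ f₂ lam R₀ K) : 0 < K := one_pos.trans_le h.one_le

lemma cont₁ (h : IsPathCorridor a H f₁ f₂ lam R₀ K) : Continuous f₁ :=
  continuous_iff_continuousAt.2 fun x => (h.ode₁ x).continuousAt

lemma cont₂ (h : IsPathCorridor a H f₁ f₂ lam R₀ K) : Continuous f₂ :=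
  continuous_iff_continuousAt.2 fun x => (h.ode₂ x).continuousAt

lemma continuous_excess (h : IsPathCorridor a H f₁ f₂ lam R₀ K) :
    Continuous fun q : ℝ × ℝ => excess K H f₁ f₂ q.1 q.2 := by
  have h1 := h.cont₁
  have h2 := h.cont₂
  have hr : Continuous fun q : ℝ × ℝ => ramp (f₂ q.2 - f₁ q.2) q.1 := by
    unfold ramp; fun_prop
  unfold excess
  refine (hr.const_mul K).sub ((h.H_cont.comp (f := fun q : ℝ × ℝ =>
    (f₁ q.2 + ramp (f₂ q.2 - f₁ q.2) q.1, q.2)) ?_).sub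
    (h.H_cont.comp (f := fun q : ℝ × ℝ => (f₁ q.2, q.2)) ?_))
  · exact ((h1.comp continuous_snd).add hr).prodMk continuous_snd
  · fun_prop

lemma abs_add_ramp_le (h : IsPathCorridor a H f₁ f₂ lam R₀ K) (d x : ℝ) :
    |f₁ x + ramp (f₂ x - f₁ x) d| ≤ 5 * R₀ + 1 := by
  have h1 := abs_le.1 (h.bound₁ x)
  have h2 := abs_le.1 (h.bound₂ x)
  have h3 := ramp_nonneg (f₂ x - f₁ x) d
  have h4 := ramp_le (sub_nonneg.2 (h.lt x).le) d
  have := h.R₀_pos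
  exact abs_le.2 ⟨by linarith, by linarith⟩

lemma lip_ramp (h : IsPathCorridor a H f₁ f₂ lam R₀ K) (d e x : ℝ) :
    |H (f₁ x + ramp (f₂ x - f₁ x) d) x - H (f₁ x + ramp (f₂ x - f₁ x) e) x| ≤
      K * |ramp (f₂ x - f₁ x) d - ramp (f₂ x - f₁ x) e| := by
  simpa using h.lip _ _ x (h.abs_add_ramp_le d x) (h.abs_add_ramp_le e x)

lemma excess_mono (h : IsPathCorridor a H f₁ f₂ lam R₀ K) (x : ℝ) :
    Monotone fun d => excess K H f₁ f₂ d x := by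
  intro d e hde
  have h1 := h.lip_ramp e d x
  have h2 := ramp_mono (f₂ x - f₁ x) hde
  rw [abs_of_nonneg (sub_nonneg.2 h2)] at h1
  have := (abs_le.1 h1).2
  simp only [excess]
  linarith

lemma excess_of_nonpos {d x : ℝ} (hd : d ≤ 0) : excess K H f₁ f₂ d x = 0 := by
  simp [excess, ramp_of_nonpos hd]

lemma excess_nonneg (h : IsPathCorridor a H f₁ f₂ lam R₀ K) (d x : ℝ) :
    0 ≤ excess K H f₁ f₂ d x := by
  rcases le_total d 0 with hd | hd
  · rw [excess_of_nonpos hd]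
  · have := h.excess_mono x hd
    simpa only [excess_of_nonpos le_rfl] using this

lemma abs_excess_sub_le (h : IsPathCorridor a H f₁ f₂ lam R₀ K) (d e x : ℝ) :
    |excess K H f₁ f₂ d x - excess K H f₁ f₂ e x| ≤ 2 * K * |d - e| := by
  have h1 := h.lip_ramp d e x
  have h2 := abs_ramp_sub_le (f₂ x - f₁ x) d e
  have hK := h.K_pos
  have h3 : excess K H f₁ f₂ d x - excess K H f₁ f₂ e x =
      K * (ramp (f₂ x - f₁ x) d - ramp (f₂ x - f₁ x) e) -
      (H (f₁ x + ramp (f₂ x - f₁ x) d) x - H (f₁ x + ramp (f₂ x - f₁ x) e) x) := by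
    simp only [excess]; ring
  rw [h3]
  refine (abs_sub _ _).trans ?_
  rw [abs_mul, abs_of_pos hK]
  nlinarith

lemma excess_le (h : IsPathCorridor a H f₁ f₂ lam R₀ K) (d x : ℝ) :
    excess K H f₁ f₂ d x ≤ 4 * K * R₀ := by
  have h1 := h.lip_ramp d 0 x
  rw [ramp_of_nonpos le_rfl, sub_zero, add_zero, abs_of_nonneg (ramp_nonneg _ _)] at h1
  have h2 := ramp_le (sub_nonneg.2 (h.lt x).le) d
  have h4 := abs_le.1 (h.bound₁ x)
  have h5 := abs_le.1 (h.bound₂ x)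
  have h6 := (abs_le.1 h1).1
  have hK := h.K_pos
  simp only [excess]
  nlinarith

end IsPathCorridor

namespace IsCorrection

lemma nonneg (hc : IsCorrection a H f₁ f₂ K δ s d) (h : IsPathCorridor a H f₁ f₂ lam R₀ K)
    (hδ : 0 ≤ δ) (x : ℝ) : 0 ≤ d x := by
  rcases le_total x s with hx | hx
  · rw [hc.2 x hx]
  refine nonneg_of_neg_mul_abs_le_deriv (c := fun x => K / a x)
    (continuous_const.div h.a_cont fun x => (h.a_pos x).ne') hc.1 (fun x _ => ?_)
    (hc.2 s le_rfl).ge hx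
  rw [div_mul_eq_mul_div, ← neg_div]
  have h1 := h.excess_nonneg (d x) x
  have h2 := ramp_nonneg 1 (x - s)
  have h3 := mul_le_mul_of_nonneg_left (le_abs_self (d x)) h.K_pos.le
  have h4 := mul_nonneg hδ h2
  exact div_le_div_of_nonneg_right (by linarith) (h.a_pos x).le

lemma le_of_le {s' : ℝ} {d' : ℝ → ℝ} (hc : IsCorrection a H f₁ f₂ K δ s d)
    (hc' : IsCorrection a H f₁ f₂ K δ s' d') (h : IsPathCorridor a H f₁ f₂ lam R₀ K)
    (hδ : 0 ≤ δ) (hs : s' ≤ s) (x : ℝ) : d x ≤ d' x := by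
  rcases le_total x s with hx | hx
  · rw [hc.2 x hx]; exact hc'.nonneg h hδ x
  rw [← sub_nonneg]
  refine nonneg_of_neg_mul_abs_le_deriv (c := fun x => 3 * K / a x) (h := fun x => d' x - d x)
    (continuous_const.div h.a_cont fun x => (h.a_pos x).ne')
    (fun x => (hc'.1 x).sub (hc.1 x)) (fun x _ => ?_) (x₁ := s) ?_ hx
  · rw [div_mul_eq_mul_div, ← neg_div, ← sub_div]
    have h1 := neg_le_of_abs_le (h.abs_excess_sub_le (d' x) (d x) x)
    have h2 := ramp_mono 1 (by linarith : x - s ≤ x - s')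
    have h3 := mul_le_mul_of_nonneg_left (le_abs_self (d' x - d x)) h.K_pos.le
    have h4 := mul_le_mul_of_nonneg_left h2 hδ
    exact div_le_div_of_nonneg_right (by linarith) (h.a_pos x).le
  · rw [hc.2 s le_rfl, sub_zero]; exact hc'.nonneg h hδ s

lemma le_bound (hc : IsCorrection a H f₁ f₂ K δ s d) (h : IsPathCorridor a H f₁ f₂ lam R₀ K)
    (hδ : 0 ≤ δ) (hδ1 : δ ≤ 1) (x : ℝ) : d x ≤ 4 * R₀ + 1 := by
  have hR := h.R₀_pos
  rcases le_total x s with hx | hx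
  · rw [hc.2 x hx]; positivity
  rw [← sub_nonneg]
  refine nonneg_of_neg_mul_abs_le_deriv (c := fun x => K / a x) (h := fun x => 4 * R₀ + 1 - d x)
    (continuous_const.div h.a_cont fun x => (h.a_pos x).ne')
    (fun x => (hc.1 x).const_sub _) (fun x _ => ?_) (x₁ := s) ?_ hx
  · rw [div_mul_eq_mul_div, ← neg_div, ← neg_div]
    have h1 := h.excess_le (d x) x
    have h2 := ramp_le zero_le_one (x - s)
    have h3 := mul_le_mul_of_nonneg_left (le_abs_self (4 * R₀ + 1 - d x)) h.K_pos.le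
    have h4 : δ * ramp 1 (x - s) ≤ K := by nlinarith [h.one_le, ramp_nonneg 1 (x - s)]
    exact div_le_div_of_nonneg_right (by linarith) (h.a_pos x).le
  · rw [hc.2 s le_rfl, sub_zero]; positivity

lemma sub_le_of_le (hc : IsCorrection a H f₁ f₂ K δ s d) (h : IsPathCorridor a H f₁ f₂ lam R₀ K)
    (hδ : 0 ≤ δ) {x₁ x : ℝ} (h1 : f₂ x₁ - f₁ x₁ ≤ d x₁) (hx : x₁ ≤ x) : f₂ x - f₁ x ≤ d x := by
  rw [← sub_nonneg]
  refine nonneg_of_neg_mul_abs_le_deriv (c := fun x => K / a x)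
    (h := fun x => d x - (f₂ x - f₁ x))
    (continuous_const.div h.a_cont fun x => (h.a_pos x).ne')
    (fun x => (hc.1 x).sub ((h.ode₂ x).sub (h.ode₁ x))) (fun x _ => ?_) (sub_nonneg.2 h1) hx
  rw [div_mul_eq_mul_div, ← neg_div, ← sub_div, ← sub_div]
  refine div_le_div_of_nonneg_right ?_ (h.a_pos x).le
  have h4 := mul_nonneg hδ (ramp_nonneg 1 (x - s))
  have hD := (h.lt x)
  rcases le_total (f₂ x - f₁ x) (d x) with hd | hd
  · rw [excess, ramp_of_ge (by linarith) hd, abs_of_nonneg (by linarith)]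
    rw [add_sub_cancel]
    linarith
  · have h0 := hc.nonneg h hδ x
    have hl := h.lip_ramp (f₂ x - f₁ x) (d x) x
    rw [excess]
    rw [ramp_of_mem h0 hd] at *
    rw [ramp_of_mem (by linarith) le_rfl, add_sub_cancel, abs_sub_comm _ (d x)] at hl
    have := neg_le_of_abs_le hl
    linarith

lemma hasDerivAt_add (hc : IsCorrection a H f₁ f₂ K δ s d)
    (h : IsPathCorridor a H f₁ f₂ lam R₀ K) (x : ℝ) :
    HasDerivAt (fun x => f₁ x + d x) ((lam - H (f₁ x) x + (-K * d x +
      excess K H f₁ f₂ (d x) x + δ * ramp 1 (x - s))) / a x) x := by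
  rw [add_div]
  exact (h.ode₁ x).add (hc.1 x)

lemma supersolution (hc : IsCorrection a H f₁ f₂ K δ s d)
    (h : IsPathCorridor a H f₁ f₂ lam R₀ K) (hδ : 0 ≤ δ) (hδ1 : δ ≤ 1) (x : ℝ) :
    a x * deriv (fun x => f₁ x + d x) x + H (f₁ x + d x) x ≤ lam + δ := by
  rw [(hc.hasDerivAt_add h x).deriv, mul_div_cancel₀ _ (h.a_pos x).ne']
  have h0 := hc.nonneg h hδ x
  have hb := hc.le_bound h hδ hδ1 x
  have h4 : δ * ramp 1 (x - s) ≤ δ := mul_le_of_le_one_right hδ (ramp_le zero_le_one _)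
  have hD := (h.lt x)
  have hR := h.R₀_pos
  rcases le_total (f₂ x - f₁ x) (d x) with hd | hd
  · have h1 := abs_le.1 (h.bound₁ x)
    have h2 := abs_le.1 (h.bound₂ x)
    rw [excess, ramp_of_ge (by linarith) hd]
    have := h.lip (f₁ x + d x) (f₂ x) x (abs_le.2 ⟨by linarith, by linarith⟩)
      (abs_le.2 ⟨by linarith, by linarith⟩)
    rw [abs_of_nonneg (by linarith : 0 ≤ f₁ x + d x - f₂ x)] at this
    have := le_of_abs_le this
    rw [add_sub_cancel]
    linarith
  · rw [excess, ramp_of_mem h0 hd]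
    linarith

lemma continuous (hc : IsCorrection a H f₁ f₂ K δ s d) : Continuous d :=
  continuous_iff_continuousAt.2 fun x => (hc.1 x).continuousAt

lemma contDiff_add (hc : IsCorrection a H f₁ f₂ K δ s d)
    (h : IsPathCorridor a H f₁ f₂ lam R₀ K) : ContDiff ℝ 1 fun x => f₁ x + d x := by
  rw [contDiff_one_iff_deriv]
  refine ⟨fun x => (hc.hasDerivAt_add h x).differentiableAt, ?_⟩
  rw [funext fun x => (hc.hasDerivAt_add h x).deriv]
  have h1 := hc.continuous
  have h2 := h.continuous_excess.comp (h1.prodMk continuous_id)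
  have h3 := h.H_cont.comp (h.cont₁.prodMk continuous_id)
  have h4 : Continuous fun x => ramp 1 (x - s) := by unfold ramp; fun_prop
  exact ((continuous_const.sub h3).add (((continuous_const.mul h1).add h2).add
    (continuous_const.mul h4))).div h.a_cont fun x => (h.a_pos x).ne'

lemma integral_growth (hc : IsCorrection a H f₁ f₂ K δ s d)
    (h : IsPathCorridor a H f₁ f₂ lam R₀ K) (hδ : 0 ≤ δ) (hδ1 : δ ≤ 1) {m p₁ p₂ θ c N : ℝ}
    (hm : 0 ≤ m) (hs : s ≤ 0) (hhit : f₂ m - f₁ m ≤ d m)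
    (h₂ : ∀ x, 0 ≤ x → p₂ * x - N ≤ ∫ r in (0:ℝ)..x, f₂ r)
    (h₁ : ∀ x, 0 ≤ x → ∫ r in (-x)..(0:ℝ), f₁ r ≤ p₁ * x + N)
    (hc₁ : p₁ + c ≤ θ) (hc₂ : θ + c ≤ p₂) (x : ℝ) :
    θ * x + c * |x| - (N + (4 * R₀ + 1) * (m - s)) ≤ ∫ r in (0:ℝ)..x, (f₁ r + d r) := by
  have hR := h.R₀_pos
  have i₁ : ∀ u v, IntervalIntegrable f₁ volume u v := fun u v => h.cont₁.intervalIntegrable _ _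
  have i₂ : ∀ u v, IntervalIntegrable f₂ volume u v := fun u v => h.cont₂.intervalIntegrable _ _
  have id : ∀ u v, IntervalIntegrable d volume u v := fun u v => hc.continuous.intervalIntegrable _ _
  have hfm : 0 ≤ (4 * R₀ + 1) * m := by positivity
  have hfs : 0 ≤ (4 * R₀ + 1) * (-s) := mul_nonneg (by positivity) (by linarith)
  rcases le_total 0 x with hx | hx
  · rw [abs_of_nonneg hx]
    have key : -((4 * R₀ + 1) * m) ≤ ∫ r in (0:ℝ)..x, (f₁ r + d r - f₂ r) := by
      have hci : ∀ u v, IntervalIntegrable (fun r => f₁ r + d r - f₂ r) volume u v :=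
        fun u v => ((i₁ u v).add (id u v)).sub (i₂ u v)
      have hlow : ∀ r, -(4 * R₀ + 1) ≤ f₁ r + d r - f₂ r := fun r => by
        have h1 := abs_le.1 (h.bound₁ r)
        have h2 := abs_le.1 (h.bound₂ r)
        have h3 := hc.nonneg h hδ r
        linarith
      have hpart : ∀ y, 0 ≤ y → -((4 * R₀ + 1) * y) ≤ ∫ r in (0:ℝ)..y, (f₁ r + d r - f₂ r) := by
        intro y hy
        have := intervalIntegral.integral_mono_on hy (intervalIntegrable_const (c := -(4 * R₀ + 1)))
          (hci 0 y) fun r _ => hlow r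
        rw [intervalIntegral.integral_const, smul_eq_mul] at this
        linarith
      rcases le_total x m with hxm | hxm
      · refine le_trans ?_ (hpart x hx)
        nlinarith
      · rw [← intervalIntegral.integral_add_adjacent_intervals (hci 0 m) (hci m x)]
        have : 0 ≤ ∫ r in m..x, (f₁ r + d r - f₂ r) :=
          intervalIntegral.integral_nonneg hxm fun r hr => by
            linarith [hc.sub_le_of_le h hδ hhit hr.1]
        linarith [hpart m hm]
    rw [intervalIntegral.integral_sub ((i₁ _ _).add (id _ _)) (i₂ _ _)] at key
    have := h₂ x hx
    nlinarith
  · rw [abs_of_nonpos hx, intervalIntegral.integral_symm]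
    have key : ∫ r in x..(0:ℝ), d r ≤ (4 * R₀ + 1) * (-s) := by
      have hpart : ∀ y, y ≤ 0 → ∫ r in y..(0:ℝ), d r ≤ (4 * R₀ + 1) * (-y) := by
        intro y hy
        have := intervalIntegral.integral_mono_on hy (id y 0)
          (intervalIntegrable_const (c := 4 * R₀ + 1)) fun r _ => hc.le_bound h hδ hδ1 r
        rw [intervalIntegral.integral_const, smul_eq_mul] at this
        linarith
      rcases le_total s x with hsx | hsx
      · refine (hpart x hx).trans ?_
        nlinarith
      · rw [← intervalIntegral.integral_add_adjacent_intervals (id x s) (id s 0)]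
        have : ∫ r in x..s, d r = 0 :=
          intervalIntegral.integral_zero_ae (ae_of_all _ fun r hr => by
            rw [uIoc_of_le hsx] at hr
            exact hc.2 r hr.2)
        rw [this, zero_add]
        exact hpart s hs
    rw [intervalIntegral.integral_add (i₁ _ _) (id _ _)]
    have := h₁ (-x) (by linarith)
    rw [neg_neg] at this
    nlinarith

end IsCorrection

end Path

section Path

variable {a : ℝ → ℝ} {H : ℝ → ℝ → ℝ} {f₁ f₂ : ℝ → ℝ} {lam R₀ K δ s : ℝ} {d : ℝ → ℝ}

lemma IsCorrection.shift {a' f₁' f₂' : ℝ → ℝ} {H' : ℝ → ℝ → ℝ} {z : ℝ}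
    (hc : IsCorrection a H f₁ f₂ K δ s d) (ha : ∀ x, a' x = a (x + z))
    (hH : ∀ p x, H' p x = H p (x + z)) (h₁ : ∀ x, f₁' x = f₁ (x + z))
    (h₂ : ∀ x, f₂' x = f₂ (x + z)) :
    IsCorrection a' H' f₁' f₂' K δ (s - z) fun x => d (x + z) := by
  refine ⟨fun x => ?_, fun x hx => hc.2 _ (by linarith)⟩
  have := (hc.1 (x + z)).comp_add_const x z
  have he : excess K H' f₁' f₂' (d (x + z)) x = excess K H f₁ f₂ (d (x + z)) (x + z) := by
    simp only [excess, hH, h₁, h₂]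
  rw [he, ha, show x - (s - z) = x + z - s by ring]
  exact this

lemma IsCorrection.hasDerivAt_of_tendsto {d : ℕ → ℝ → ℝ} {Z : ℝ → ℝ}
    (h : IsPathCorridor a H f₁ f₂ lam R₀ K) (hδ : 0 ≤ δ) (hδ1 : δ ≤ 1)
    (hc : ∀ n : ℕ, IsCorrection a H f₁ f₂ K δ (-n) (d n))
    (hZ : ∀ x, Tendsto (fun n => d n x) atTop (nhds (Z x))) (x : ℝ) :
    HasDerivAt Z ((-K * Z x + excess K H f₁ f₂ (Z x) x + δ) / a x) x := by
  have hRamp : ∀ n : ℕ, Continuous fun x : ℝ => ramp 1 (x - -(n:ℝ)) := fun n => by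
    unfold ramp; fun_prop
  have hFc : ∀ n : ℕ, Continuous fun x =>
      (-K * d n x + excess K H f₁ f₂ (d n x) x + δ * ramp 1 (x - -(n:ℝ))) / a x := fun n =>
    ((((hc n).continuous.const_mul _).add (h.continuous_excess.comp
      ((hc n).continuous.prodMk continuous_id))).add ((hRamp n).const_mul _)).div h.a_cont
      fun x => (h.a_pos x).ne'
  refine hasDerivAt_of_tendsto_of_eq_integral (z := d)
    (F := fun n x => (-K * d n x + excess K H f₁ f₂ (d n x) x + δ * ramp 1 (x - -(n:ℝ))) / a x)
    (Θ := fun y x => (-K * y + excess K H f₁ f₂ y x + δ) / a x)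
    (b := fun x => (K * (4 * R₀ + 1) + 4 * K * R₀ + 1) / a x) (s := 0) ?_ hFc ?_ ?_ ?_ hZ ?_ x
  · exact (((continuous_fst.const_mul _).add h.continuous_excess).add continuous_const).div
      (h.a_cont.comp continuous_snd) fun q => (h.a_pos q.2).ne'
  · exact continuous_const.div h.a_cont fun x => (h.a_pos x).ne'
  · intro n x
    rw [abs_div, abs_of_pos (h.a_pos x)]
    refine div_le_div_of_nonneg_right ?_ (h.a_pos x).le
    have h0 := (hc n).nonneg h hδ x
    have hb := mul_le_mul_of_nonneg_left ((hc n).le_bound h hδ hδ1 x) h.K_pos.le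
    have he0 := h.excess_nonneg (d n x) x
    have he := h.excess_le (d n x) x
    have hr0 := mul_nonneg hδ (ramp_nonneg 1 (x - -(n:ℝ)))
    have hr1 : δ * ramp 1 (x - -(n:ℝ)) ≤ 1 :=
      mul_le_one₀ hδ1 (ramp_nonneg _ _) (ramp_le zero_le_one _)
    have hK := h.K_pos
    have hR := h.R₀_pos
    have := mul_nonneg hK.le h0
    have := mul_pos hK hR
    exact abs_le.2 ⟨by linarith, by linarith⟩
  · intro n x
    rw [intervalIntegral.integral_eq_sub_of_hasDerivAt (fun y _ => (hc n).1 y)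
      ((hFc n).intervalIntegrable _ _)]
    ring
  · intro x
    refine Tendsto.div_const (((hZ x).const_mul _).add ?_ |>.add ?_) _
    · exact ((h.continuous_excess.comp (continuous_id.prodMk continuous_const)).tendsto
        (Z x)).comp (hZ x)
    · refine tendsto_const_nhds.congr' ?_
      obtain ⟨N, hN⟩ := exists_nat_ge (1 - x)
      filter_upwards [eventually_ge_atTop N] with n hn
      have : (N:ℝ) ≤ n := by exact_mod_cast hn
      rw [ramp_of_ge zero_le_one (by linarith), mul_one]

lemma IsPathCorridor.lt_of_hasDerivAt {Z : ℝ → ℝ} (h : IsPathCorridor a H f₁ f₂ lam R₀ K)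
    (hδ : 0 < δ) (hZ : ∀ x, HasDerivAt Z ((-K * Z x + excess K H f₁ f₂ (Z x) x + δ) / a x) x)
    (h0 : ∀ x, 0 ≤ Z x) (h1 : ∀ x, Z x ≤ f₂ x - f₁ x) (x : ℝ) : 0 < Z x ∧ Z x < f₂ x - f₁ x := by
  have hax := h.a_pos x
  constructor
  · refine (h0 x).lt_of_ne' fun he => ?_
    have hmin : IsLocalMin Z x := Eventually.of_forall fun y => by
      rw [he]; exact h0 y
    have := hmin.hasDerivAt_eq_zero (hZ x)
    rw [he, IsPathCorridor.excess_of_nonpos le_rfl, div_eq_zero_iff] at this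
    rcases this with h | h <;> linarith
  · refine (h1 x).lt_of_ne fun he => ?_
    have hmax : IsLocalMax (fun y => Z y - (f₂ y - f₁ y)) x := Eventually.of_forall fun y => by
      change Z y - (f₂ y - f₁ y) ≤ Z x - (f₂ x - f₁ x)
      rw [he, sub_self, sub_nonpos]; exact h1 y
    have := hmax.hasDerivAt_eq_zero ((hZ x).sub ((h.ode₂ x).sub (h.ode₁ x)))
    rw [he, excess, ramp_of_ge (sub_nonneg.2 (h.lt x).le) le_rfl, add_sub_cancel, ← sub_div,
      ← sub_div, div_eq_zero_iff] at this
    rcases this with h | h <;> linarith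

lemma IsPathCorridor.ode_add {Z : ℝ → ℝ} (h : IsPathCorridor a H f₁ f₂ lam R₀ K)
    (hZ : ∀ x, HasDerivAt Z ((-K * Z x + excess K H f₁ f₂ (Z x) x + δ) / a x) x)
    (h0 : ∀ x, 0 ≤ Z x) (h1 : ∀ x, Z x ≤ f₂ x - f₁ x) (x : ℝ) :
    HasDerivAt (fun x => f₁ x + Z x) ((lam + δ - H (f₁ x + Z x) x) / a x) x := by
  have := (h.ode₁ x).add (hZ x)
  rw [excess, ramp_of_mem (h0 x) (h1 x), ← add_div] at this
  refine this.congr_deriv ?_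
  congr 1
  ring

end Path

section Setting

variable {Ω : Type} [MeasurableSpace Ω] {P : Measure Ω} {τ : ℝ → Ω → Ω}
  {a : ℝ → Ω → ℝ} {H : ℝ → ℝ → Ω → ℝ} {lam R₀ K δ : ℝ} {f₁ f₂ : ℝ → Ω → ℝ} {G : Set Ω}

namespace IsCorridor

lemma exists_isPathCorridor (h : IsCorridor P τ a H lam f₁ f₂ G R₀) :
    ∃ K, ∀ ω ∈ G, IsPathCorridor (fun x => a x ω) (fun p x => H p x ω) (fun x => f₁ x ω)
      (fun x => f₂ x ω) lam R₀ K := by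
  have := h.pos
  obtain ⟨K, hK, hl⟩ := h.env.H_lip (5 * R₀ + 1) (by positivity)
  refine ⟨max K 1, fun ω hω => ⟨h.env.a_cont ω, fun x => h.env.a_pos x ω, h.env.H_cont ω, h.pos,
    le_max_right _ _, fun p q x hp hq => (hl p q x ω hp hq).trans ?_, h.bound₁ ω hω, h.bound₂ ω hω,
    h.ode₁ ω hω, h.ode₂ ω hω, h.lt ω hω⟩⟩
  gcongr
  exact le_max_left _ _

lemma exists_isCorrection (h : IsCorridor P τ a H lam f₁ f₂ G R₀)
    (hP : ∀ ω ∈ G, IsPathCorridor (fun x => a x ω) (fun p x => H p x ω) (fun x => f₁ x ω)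
      (fun x => f₂ x ω) lam R₀ K) (hδ : 0 ≤ δ) (s : ℝ) :
    ∃ d : ℝ → Ω → ℝ, (Measurable fun q : ℝ × Ω => d q.1 q.2) ∧
      ∀ ω ∈ G, IsCorrection (fun x => a x ω) (fun p x => H p x ω) (fun x => f₁ x ω)
        (fun x => f₂ x ω) K δ s fun x => d x ω := by
  set A : ℝ → Ω → ℝ := fun x ω => ∫ r in (0:ℝ)..x, K / a r ω with hA
  have hAm : Measurable fun q : ℝ × Ω => A q.1 q.2 :=
    measurable_intervalIntegral_uncurry (f := fun r ω => K / a r ω)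
      (measurable_const.div h.env.meas_a) 0
  have hAd : ∀ ω x, HasDerivAt (fun x => A x ω) (K / a x ω) x := fun ω x =>
    hasDerivAt_integral_of_continuous (continuous_const.div (h.env.a_cont ω)
      fun x => (h.env.a_pos x ω).ne') 0 x
  have hAc : ∀ ω, Continuous fun x => A x ω := fun ω =>
    continuous_iff_continuousAt.2 fun x => (hAd ω x).continuousAt
  have hrm : ∀ {g k : (ℝ × ℝ) × Ω → ℝ}, Measurable g → Measurable k →
      Measurable fun q => ramp (g q) (k q) := fun hg hk => by
    unfold ramp; exact measurable_const.max (hk.min hg)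
  have hsnd : Measurable fun q : (ℝ × ℝ) × Ω => (q.1.2, q.2) :=
    (measurable_snd.comp measurable_fst).prodMk measurable_snd
  have hf₁ : Measurable fun q : (ℝ × ℝ) × Ω => f₁ q.1.2 q.2 := h.meas₁.comp hsnd
  have hf₂ : Measurable fun q : (ℝ × ℝ) × Ω => f₂ q.1.2 q.2 := h.meas₂.comp hsnd
  have hAm' : Measurable fun q : (ℝ × ℝ) × Ω => A q.1.2 q.2 := hAm.comp hsnd
  have ham' : Measurable fun q : (ℝ × ℝ) × Ω => a q.1.2 q.2 := h.env.meas_a.comp hsnd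
  have hexm : ∀ {k : (ℝ × ℝ) × Ω → ℝ}, Measurable k → Measurable fun q : (ℝ × ℝ) × Ω =>
      excess K (fun p x => H p x q.2) (fun x => f₁ x q.2) (fun x => f₂ x q.2) (k q) q.1.2 := by
    intro k hk
    have hr := hrm (hf₂.sub hf₁) hk
    unfold excess
    exact (hr.const_mul K).sub ((h.env.meas_H.comp ((hf₁.add hr).prodMk hsnd)).sub
      (h.env.meas_H.comp (hf₁.prodMk hsnd)))
  let Θ : ℝ → ℝ → Ω → ℝ := fun y x ω => Real.exp (A x ω) *
    (excess K (fun p x => H p x ω) (fun x => f₁ x ω) (fun x => f₂ x ω)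
      (Real.exp (-A x ω) * y) x + δ * ramp 1 (x - s)) / a x ω
  obtain ⟨Y, hYm, hY⟩ := exists_measurable_solution (Θ := Θ)
    (b := fun x ω => Real.exp (A x ω) * (4 * K * R₀ + δ) / a x ω) (G := G) (by
      refine ((Real.measurable_exp.comp hAm').mul ((hexm ((Real.measurable_exp.comp
        hAm'.neg).mul (measurable_fst.comp measurable_fst))).add ?_)).div ham'
      exact (hrm measurable_const
        ((measurable_snd.comp measurable_fst).sub measurable_const)).const_mul δ) s
    (by
      intro ω hω
      have hA2 : Continuous fun q : ℝ × ℝ => A q.2 ω := (hAc ω).comp continuous_snd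
      have hr : Continuous fun q : ℝ × ℝ => ramp 1 (q.2 - s) := by unfold ramp; fun_prop
      refine ((Real.continuous_exp.comp hA2).mul (((hP ω hω).continuous_excess.comp
        (((Real.continuous_exp.comp hA2.neg).mul continuous_fst).prodMk continuous_snd)).add
        (hr.const_mul δ))).div ((h.env.a_cont ω).comp continuous_snd)
        fun q => (h.env.a_pos q.2 ω).ne')
    (by
      intro ω hω x y y' hyy
      have := (hP ω hω).excess_mono x
        (mul_le_mul_of_nonneg_left hyy (Real.exp_pos (-A x ω)).le)
      exact div_le_div_of_nonneg_right (mul_le_mul_of_nonneg_left (add_le_add_left this _)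
        (Real.exp_pos _).le) (h.env.a_pos x ω).le)
    (by
      intro ω hω y x
      exact div_nonneg (mul_nonneg (Real.exp_pos _).le (add_nonneg
        ((hP ω hω).excess_nonneg _ _) (mul_nonneg hδ (ramp_nonneg _ _)))) (h.env.a_pos x ω).le)
    (by
      intro ω hω y x
      refine div_le_div_of_nonneg_right (mul_le_mul_of_nonneg_left (add_le_add
        ((hP ω hω).excess_le _ _) (mul_le_of_le_one_right hδ (ramp_le zero_le_one _)))
        (Real.exp_pos _).le) (h.env.a_pos x ω).le)
    (by
      intro ω hω
      exact ((Real.continuous_exp.comp (hAc ω)).mul continuous_const).div (h.env.a_cont ω)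
        fun x => (h.env.a_pos x ω).ne')
    (by
      intro ω hω x hx
      change Real.exp (A x ω) * (excess _ _ _ _ _ _ + _) / _ = 0
      rw [mul_zero, IsPathCorridor.excess_of_nonpos le_rfl, ramp_of_nonpos (by linarith)]
      simp)
  refine ⟨fun x ω => Real.exp (-A x ω) * Y x ω, (Real.measurable_exp.comp hAm.neg).mul hYm,
    fun ω hω => ⟨fun x => ?_, fun x hx => ?_⟩⟩
  · have := ((hAd ω x).neg.exp).mul ((hY ω hω).1 x)
    refine this.congr_deriv ?_
    simp only [Θ, Pi.neg_apply]
    have he : Real.exp (-A x ω) * Real.exp (A x ω) = 1 := by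
      rw [← Real.exp_add, neg_add_cancel, Real.exp_zero]
    have ha := (h.env.a_pos x ω).ne'
    generalize excess K (fun p x => H p x ω) (fun x => f₁ x ω) (fun x => f₂ x ω)
      (Real.exp (-A x ω) * Y x ω) x = E
    field_simp
    linear_combination (E + δ * ramp 1 (x - s)) * he
  · simp only [(hY ω hω).2 x hx, mul_zero]

end IsCorridor

end Setting

lemma integral_lt_integral_of_ae_lt {Ω : Type} [MeasurableSpace Ω] {P : Measure Ω}
    [IsProbabilityMeasure P] {f g : Ω → ℝ} (hf : Integrable f P) (hg : Integrable g P)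
    (h : ∀ᵐ ω ∂P, f ω < g ω) : ∫ ω, f ω ∂P < ∫ ω, g ω ∂P := by
  rw [← sub_pos, ← integral_sub hg hf]
  refine (integral_pos_iff_support_of_nonneg_ae (h.mono fun ω hω => (sub_pos.2 hω).le)
    (hg.sub hf)).2 ?_
  have : ∀ᵐ ω ∂P, ω ∈ Function.support fun ω => g ω - f ω :=
    h.mono fun ω hω => (sub_pos.2 hω).ne'
  rw [pos_iff_ne_zero]
  intro h0
  have h1 : ∀ᵐ ω ∂P, ω ∉ Function.support fun ω => g ω - f ω := measure_eq_zero_iff_ae_notMem.1 h0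
  exact (this.and h1).exists.elim fun _ h => h.2 h.1

namespace IsCorridor

variable {Ω : Type} [MeasurableSpace Ω] {P : Measure Ω} {τ : ℝ → Ω → Ω}
  {a : ℝ → Ω → ℝ} {H : ℝ → ℝ → Ω → ℝ} {lam R₀ K δ : ℝ} {f₁ f₂ : ℝ → Ω → ℝ} {G : Set Ω}

lemma shift_eq (h : IsCorridor P τ a H lam f₁ f₂ G R₀) {f : ℝ → Ω → ℝ}
    (hs : ∀ x ω, f x ω = f 0 (τ x ω)) (x z : ℝ) (ω : Ω) : f x (τ z ω) = f (x + z) ω := by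
  rw [hs, ← h.env.flow.add, ← hs]

lemma isCorrection_shift (h : IsCorridor P τ a H lam f₁ f₂ G R₀) {s : ℝ} {ω : Ω} {d : ℝ → ℝ} (z : ℝ)
    (hc : IsCorrection (fun x => a x ω) (fun p x => H p x ω) (fun x => f₁ x ω)
        (fun x => f₂ x ω) K δ s d) :
    IsCorrection (fun x => a x (τ z ω)) (fun p x => H p x (τ z ω)) (fun x => f₁ x (τ z ω))
        (fun x => f₂ x (τ z ω)) K δ (s - z) fun x => d (x + z) :=
  hc.shift (fun x => h.shift_eq h.env.a_stat x z ω)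
    (fun p x => h.shift_eq (f := fun x ω => H p x ω) (h.env.H_stat p) x z ω)
    (fun x => h.shift_eq h.stat₁ x z ω) fun x => h.shift_eq h.stat₂ x z ω

/-- If the corrections never cross the corridor, their limit is a stationary solution with mean
inside the corridor. -/
lemma exists_mem_Eset (h : IsCorridor P τ a H lam f₁ f₂ G R₀)
    (hP : ∀ ω ∈ G, IsPathCorridor (fun x => a x ω) (fun p x => H p x ω) (fun x => f₁ x ω)
      (fun x => f₂ x ω) lam R₀ K) (hδ : 0 < δ) (hδ1 : δ ≤ 1) {d : ℕ → ℝ → Ω → ℝ}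
    (hdm : ∀ n, Measurable fun q : ℝ × Ω => d n q.1 q.2)
    (hd : ∀ n : ℕ, ∀ ω ∈ G, IsCorrection (fun x => a x ω) (fun p x => H p x ω) (fun x => f₁ x ω)
        (fun x => f₂ x ω) K δ (-n) fun x => d n x ω)
    {G' : Set Ω} (hG' : MeasurableSet G') (hsub : G' ⊆ G) (hinv : ∀ x ω, τ x ω ∈ G' ↔ ω ∈ G')
    (hae : ∀ᵐ ω ∂P, ω ∈ G') (hlt : ∀ ω ∈ G', ∀ n x, d n x ω ≤ f₂ x ω - f₁ x ω) :
    ∃ θ ∈ Eset P τ a H, θ ∈ Ioo (∫ ω, f₁ 0 ω ∂P) (∫ ω, f₂ 0 ω ∂P) := by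
  classical
  have := h.env.flow.prob
  let Z : ℝ → Ω → ℝ := fun x ω => ⨆ n, d n x ω
  have hZm : Measurable fun q : ℝ × Ω => Z q.1 q.2 := Measurable.iSup fun n => hdm n
  have hbdd : ∀ ω ∈ G, ∀ x, BddAbove (range fun n => d n x ω) := by
    rintro ω hω x
    refine ⟨4 * R₀ + 1, ?_⟩
    rintro _ ⟨n, rfl⟩
    exact (hd n ω hω).le_bound (hP ω hω) hδ.le hδ1 x
  have hmono : ∀ ω ∈ G, ∀ x, Monotone fun n => d n x ω := fun ω hω x n m hnm =>
    (hd n ω hω).le_of_le (hd m ω hω) (hP ω hω) hδ.le (by simpa using hnm) x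
  have hlim : ∀ ω ∈ G, ∀ x, Tendsto (fun n => d n x ω) atTop (nhds (Z x ω)) := fun ω hω x =>
    tendsto_atTop_ciSup (hmono ω hω x) (hbdd ω hω x)
  have hZle : ∀ ω ∈ G, ∀ z x, Z (x + z) ω ≤ Z x (τ z ω) := by
    intro ω hω z x
    refine ciSup_le fun n => ?_
    have hτ := (h.inv z ω).2 hω
    obtain ⟨m, hm⟩ := exists_nat_ge (n + z)
    have := (h.isCorrection_shift z (hd n ω hω)).le_of_le (hd m _ hτ) (hP _ hτ) hδ.le
      (by linarith) x
    exact this.trans (le_ciSup (hbdd _ hτ x) m)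
  have hZs : ∀ ω ∈ G, ∀ z x, Z x (τ z ω) = Z (x + z) ω := by
    intro ω hω z x
    refine le_antisymm ?_ (hZle ω hω z x)
    have := hZle (τ z ω) ((h.inv z ω).2 hω) (-z) (x + z)
    rwa [← h.env.flow.add, neg_add_cancel, h.env.flow.zero, add_neg_cancel_right] at this
  have hZd : ∀ ω ∈ G, _ := fun ω hω => IsCorrection.hasDerivAt_of_tendsto (hP ω hω) hδ.le hδ1
    (fun n => hd n ω hω) (hlim ω hω)
  have hZ0 : ∀ ω ∈ G, ∀ x, 0 ≤ Z x ω := fun ω hω x =>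
    ge_of_tendsto' (hlim ω hω x) fun n => (hd n ω hω).nonneg (hP ω hω) hδ.le x
  have hZ1 : ∀ ω ∈ G', ∀ x, Z x ω ≤ f₂ x ω - f₁ x ω := fun ω hω x =>
    ciSup_le fun n => hlt ω hω n x
  have hode : ∀ ω ∈ G', _ := fun ω hω =>
    (hP ω (hsub hω)).ode_add (hZd ω (hsub hω)) (hZ0 ω (hsub hω)) (hZ1 ω hω)
  have hstr : ∀ ω ∈ G', _ := fun ω hω =>
    (hP ω (hsub hω)).lt_of_hasDerivAt hδ (hZd ω (hsub hω)) (hZ0 ω (hsub hω)) (hZ1 ω hω)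
  let g : ℝ → Ω → ℝ := fun x ω => if ω ∈ G' then f₁ x ω + Z x ω else 0
  have hg : ∀ ω ∈ G', ∀ x, g x ω = f₁ x ω + Z x ω := fun ω hω x => if_pos hω
  have hg' : ∀ ω ∉ G', ∀ x, g x ω = 0 := fun ω hω x => if_neg hω
  have hgm : Measurable fun q : ℝ × Ω => g q.1 q.2 :=
    Measurable.ite (measurable_snd hG') (h.meas₁.add hZm) measurable_const
  have hsol : StatSol P τ a H (lam + δ) g := by
    refine ⟨hgm, fun x ω => ?_, fun ω => ?_, ?_⟩
    · by_cases hω : ω ∈ G'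
      · rw [hg ω hω, hg _ ((hinv x ω).2 hω), ← h.stat₁, hZs ω (hsub hω), zero_add]
      · rw [hg' ω hω, hg' _ fun hc => hω ((hinv x ω).1 hc)]
    · by_cases hω : ω ∈ G'
      · simp_rw [hg ω hω]
        rw [contDiff_one_iff_deriv]
        refine ⟨fun x => (hode ω hω x).differentiableAt, ?_⟩
        rw [funext fun x => (hode ω hω x).deriv]
        have hc : Continuous fun x => f₁ x ω + Z x ω :=
          continuous_iff_continuousAt.2 fun x => (hode ω hω x).continuousAt
        exact (continuous_const.sub ((h.env.H_cont ω).comp (hc.prodMk continuous_id))).div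
          (h.env.a_cont ω) fun x => (h.env.a_pos x ω).ne'
      · simp_rw [hg' ω hω]
        exact contDiff_const
    · filter_upwards [hae] with ω hω
      refine ⟨⟨R₀, fun x => ?_⟩, fun x => ?_⟩
      · rw [hg ω hω]
        have h1 := abs_le.1 (h.bound₁ ω (hsub hω) x)
        have h2 := abs_le.1 (h.bound₂ ω (hsub hω) x)
        have h3 := hZ0 ω (hsub hω) x
        have h4 := hZ1 ω hω x
        exact abs_le.2 ⟨by linarith, by linarith⟩
      · simp_rw [hg ω hω]
        rw [(hode ω hω x).deriv, mul_div_cancel₀ _ (h.env.a_pos x ω).ne']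
        ring
  refine ⟨_, ⟨lam + δ, g, hsol, rfl⟩, ?_⟩
  have hi : ∀ {f : ℝ → Ω → ℝ}, (Measurable fun q : ℝ × Ω => f q.1 q.2) →
      (∀ ω ∈ G', |f 0 ω| ≤ R₀) → Integrable (f 0) P := fun hm hb =>
    Integrable.of_bound
      (hm.comp (measurable_const.prodMk measurable_id)).aestronglyMeasurable R₀
      (hae.mono fun ω hω => hb ω hω)
  have hi₁ := hi h.meas₁ fun ω hω => h.bound₁ ω (hsub hω) 0
  have hi₂ := hi h.meas₂ fun ω hω => h.bound₂ ω (hsub hω) 0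
  have hlt₁ : ∀ ω ∈ G', f₁ 0 ω < g 0 ω := fun ω hω => by
    rw [hg ω hω]
    linarith [(hstr ω hω 0).1]
  have hlt₂ : ∀ ω ∈ G', g 0 ω < f₂ 0 ω := fun ω hω => by
    rw [hg ω hω]
    linarith [(hstr ω hω 0).2]
  have hig := hi hgm fun ω hω => abs_le.2
    ⟨(abs_le.1 (h.bound₁ ω (hsub hω) 0)).1.trans (hlt₁ ω hω).le,
      (hlt₂ ω hω).le.trans (abs_le.1 (h.bound₂ ω (hsub hω) 0)).2⟩
  exact ⟨integral_lt_integral_of_ae_lt hi₁ hig (hae.mono hlt₁),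
    integral_lt_integral_of_ae_lt hig hi₂ (hae.mono hlt₂)⟩

lemma ae_exists_crossing (h : IsCorridor P τ a H lam f₁ f₂ G R₀)
    (hP : ∀ ω ∈ G, IsPathCorridor (fun x => a x ω) (fun p x => H p x ω) (fun x => f₁ x ω)
      (fun x => f₂ x ω) lam R₀ K) (hδ : 0 < δ) (hδ1 : δ ≤ 1) {d : ℕ → ℝ → Ω → ℝ}
    (hdm : ∀ n, Measurable fun q : ℝ × Ω => d n q.1 q.2)
    (hd : ∀ n : ℕ, ∀ ω ∈ G, IsCorrection (fun x => a x ω) (fun p x => H p x ω) (fun x => f₁ x ω)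
        (fun x => f₂ x ω) K δ (-n) fun x => d n x ω)
    (hgap : Ioo (∫ ω, f₁ 0 ω ∂P) (∫ ω, f₂ 0 ω ∂P) ∩ Eset P τ a H = ∅) :
    ∀ᵐ ω ∂P, ∃ n m : ℕ, f₂ m ω - f₁ m ω ≤ d n m ω := by
  have hF := h.env.flow
  let W : Set Ω := G ∩ {ω | ∃ n m : ℕ, f₂ m ω - f₁ m ω ≤ d n m ω}
  have hsec : ∀ {f : ℝ → Ω → ℝ}, (Measurable fun q : ℝ × Ω => f q.1 q.2) → ∀ x,
      Measurable (f x) := fun hm x => hm.comp (measurable_const.prodMk measurable_id)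
  have hW : MeasurableSet W := by
    refine h.measG.inter ?_
    simp only [ofPred_exists]
    exact MeasurableSet.iUnion fun n => MeasurableSet.iUnion fun m =>
      measurableSet_le ((hsec h.meas₂ m).sub (hsec h.meas₁ m)) (hsec (hdm n) m)
  have hWinv : ∀ z ω, ω ∈ W → τ z ω ∈ W := by
    rintro z ω ⟨hω, n, m, hnm⟩
    have hτ := (h.inv z ω).2 hω
    obtain ⟨n', hn'⟩ := exists_nat_ge (n + z)
    obtain ⟨m', hm'⟩ := exists_nat_ge (m - z)
    refine ⟨hτ, n', m', ?_⟩
    have h1 := (h.isCorrection_shift z (hd n ω hω)).le_of_le (hd n' _ hτ) (hP _ hτ) hδ.le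
      (by linarith) m'
    have h2 := (hd n ω hω).sub_le_of_le (hP ω hω) hδ.le hnm (by linarith : (m:ℝ) ≤ m' + z)
    rw [h.shift_eq h.stat₁, h.shift_eq h.stat₂]
    exact h2.trans h1
  rcases hF.ae_mem_or_ae_notMem hW hWinv with hc | hc
  · exact hc.mono fun ω hω => hω.2
  exfalso
  have hWinv' : ∀ z ω, τ z ω ∈ W ↔ ω ∈ W := fun z ω => ⟨fun hω => by
    have := hWinv (-z) _ hω
    rwa [← hF.add, neg_add_cancel, hF.zero] at this, hWinv z ω⟩
  obtain ⟨θ, hθE, hθ⟩ := h.exists_mem_Eset hP hδ hδ1 hdm hd (G' := G \ W) (h.measG.diff hW)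
    sdiff_subset (fun z ω => and_congr (h.inv z ω) (not_congr (hWinv' z ω)))
    (h.ae_mem.and hc) (by
      rintro ω ⟨hω, hωW⟩ n x
      by_contra! hlt
      obtain ⟨m, hm⟩ := exists_nat_ge x
      exact hωW ⟨hω, n, m, (hd n ω hω).sub_le_of_le (hP ω hω) hδ.le hlt.le hm⟩)
  exact (hgap ▸ (⟨hθ, hθE⟩ : θ ∈ Ioo _ _ ∩ Eset P τ a H) : θ ∈ (∅ : Set ℝ))

end IsCorridor

/-- A `C¹` strict barrier of level `lam`, whose primitive from `0` dominates, up to `C`, all slopes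
between `p₁` and `p₂`. -/
def HasBarrier (a : ℝ → ℝ) (H : ℝ → ℝ → ℝ) (lam p₁ p₂ C : ℝ) : Prop :=
  ∃ g : ℝ → ℝ, ContDiff ℝ 1 g ∧ (∀ x, a x * deriv g x + H (g x) x ≤ lam) ∧
    ∀ θ c, p₁ + c ≤ θ → θ + c ≤ p₂ → ∀ x, θ * x + c * |x| - C ≤ ∫ r in (0:ℝ)..x, g r

lemma HasBarrier.le {a a' : ℝ → ℝ} {H H' : ℝ → ℝ → ℝ} {lam p₁ p₂ C y : ℝ}
    (hb : HasBarrier a' H' lam p₁ p₂ C) (ha : ∀ x, a' x = a (x + y))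
    (hH : ∀ p x, H' p x = H p (x + y)) {θ : ℝ} (hθ : θ ∈ Ioo p₁ p₂) {v : ℝ → ℝ → ℝ}
    (hv : IsViscositySubsolution a H v)
    (huc : UniformContinuousOn (fun q : ℝ × ℝ => v q.1 q.2) {q : ℝ × ℝ | 0 ≤ q.1})
    (hinit : ∀ x, v 0 x = θ * x) {t : ℝ} (ht : 0 ≤ t) : v t y ≤ θ * y + C + lam * t := by
  obtain ⟨g, hg, hsup, hint⟩ := hb
  set c := min (θ - p₁) (p₂ - θ)
  have hc : 0 < c := lt_min (sub_pos.2 hθ.1) (sub_pos.2 hθ.2)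
  have hc₁ : p₁ + c ≤ θ := by linarith [min_le_left (θ - p₁) (p₂ - θ)]
  have hc₂ : θ + c ≤ p₂ := by linarith [min_le_right (θ - p₁) (p₂ - θ)]
  refine hv.le_of_barrier huc hinit (g := fun x => g (x - y))
    (hg.comp (contDiff_id.sub contDiff_const)) (fun x => ?_) hc (fun x => ?_) ht
  · have := hsup (x - y)
    rw [ha, hH, sub_add_cancel] at this
    rwa [deriv_comp_sub_const]
  · have := hint θ c hc₁ hc₂ (x - y)
    rwa [intervalIntegral.integral_comp_sub_right, sub_self]

namespace IsCorridor

variable {Ω : Type} [MeasurableSpace Ω] {P : Measure Ω} {τ : ℝ → Ω → Ω}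
  {a : ℝ → Ω → ℝ} {H : ℝ → ℝ → Ω → ℝ} {lam R₀ K δ : ℝ} {f₁ f₂ : ℝ → Ω → ℝ} {G : Set Ω}

lemma exists_barrier_sets (h : IsCorridor P τ a H lam f₁ f₂ G R₀) (hδ : 0 < δ) (hδ1 : δ ≤ 1)
    (hgap : Ioo (∫ ω, f₁ 0 ω ∂P) (∫ ω, f₂ 0 ω ∂P) ∩ Eset P τ a H = ∅) {p₁ p₂ : ℝ}
    (hp₁ : ∫ ω, f₁ 0 ω ∂P < p₁) (hp₂ : p₂ < ∫ ω, f₂ 0 ω ∂P) :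
    ∃ B : ℕ → Set Ω, (∀ k, MeasurableSet (B k)) ∧ Monotone B ∧ (∀ᵐ ω ∂P, ∃ k, ω ∈ B k) ∧
      ∀ k, ∃ C, ∀ ω ∈ B k,
        HasBarrier (fun x => a x ω) (fun p x => H p x ω) (lam + δ) p₁ p₂ C := by
  have hF := h.env.flow
  have := hF.prob
  obtain ⟨K, hP⟩ := h.exists_isPathCorridor
  choose d hdm hd using fun n : ℕ => h.exists_isCorrection hP hδ.le (-(n:ℝ))
  have hcross := h.ae_exists_crossing hP hδ hδ1 hdm hd hgap
  have hsec : ∀ {f : ℝ → Ω → ℝ}, (Measurable fun q : ℝ × Ω => f q.1 q.2) → ∀ x,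
      Measurable (f x) := fun hm x => hm.comp (measurable_const.prodMk measurable_id)
  have hm₁ : Measurable fun ω => p₁ - f₁ 0 ω := (hsec h.meas₁ 0).const_sub _
  have hm₂ : Measurable fun ω => f₂ 0 ω - p₂ := (hsec h.meas₂ 0).sub_const _
  have hb₁ : ∀ ω ∈ G, ∀ x, |p₁ - f₁ 0 (τ (-x) ω)| ≤ |p₁| + R₀ := fun ω hω x =>
    (abs_sub _ _).trans (by gcongr; exact h.bound₁ _ ((h.inv (-x) ω).2 hω) 0)
  have hb₂ : ∀ ω ∈ G, ∀ x, |f₂ 0 (τ x ω) - p₂| ≤ R₀ + |p₂| := fun ω hω x =>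
    (abs_sub _ _).trans (by gcongr; exact h.bound₂ _ ((h.inv x ω).2 hω) 0)
  have hi₁ : Integrable (f₁ 0) P := Integrable.of_bound (hsec h.meas₁ 0).aestronglyMeasurable R₀
    (h.ae_mem.mono fun ω hω => h.bound₁ ω hω 0)
  have hi₂ : Integrable (f₂ 0) P := Integrable.of_bound (hsec h.meas₂ 0).aestronglyMeasurable R₀
    (h.ae_mem.mono fun ω hω => h.bound₂ ω hω 0)
  have hN₁ := hF.reverse.ae_orbit_integral_bddBelow hm₁ (h.ae_mem.mono hb₁) (by
    rw [integral_sub (integrable_const _) hi₁]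
    simpa using hp₁)
  have hN₂ := hF.ae_orbit_integral_bddBelow hm₂ (h.ae_mem.mono hb₂) (by
    rw [integral_sub hi₂ (integrable_const _)]
    simpa using hp₂)
  have hI₁ : ∀ m : ℕ, Measurable fun ω => ∫ r in (0:ℝ)..m, (p₁ - f₁ 0 (τ (-r) ω)) := fun m =>
    hsec (f := fun x ω => ∫ r in (0:ℝ)..x, (p₁ - f₁ 0 (τ (-r) ω)))
      (measurable_intervalIntegral_uncurry (f := fun r ω => p₁ - f₁ 0 (τ (-r) ω))
      (hm₁.comp hF.reverse.meas) 0) m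
  have hI₂ : ∀ m : ℕ, Measurable fun ω => ∫ r in (0:ℝ)..m, (f₂ 0 (τ r ω) - p₂) := fun m =>
    hsec (f := fun x ω => ∫ r in (0:ℝ)..x, (f₂ 0 (τ r ω) - p₂))
      (measurable_intervalIntegral_uncurry (f := fun r ω => f₂ 0 (τ r ω) - p₂)
      (hm₂.comp hF.meas) 0) m
  refine ⟨fun k => G ∩ ({ω | ∃ n ≤ k, ∃ m ≤ k, f₂ (m:ℕ) ω - f₁ m ω ≤ d n m ω} ∩
    ({ω | ∀ m : ℕ, -(k:ℝ) ≤ ∫ r in (0:ℝ)..m, (p₁ - f₁ 0 (τ (-r) ω))} ∩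
     {ω | ∀ m : ℕ, -(k:ℝ) ≤ ∫ r in (0:ℝ)..m, (f₂ 0 (τ r ω) - p₂)})), fun k => ?_, ?_, ?_, ?_⟩
  · refine h.measG.inter (MeasurableSet.inter ?_ (MeasurableSet.inter ?_ ?_))
    · simp only [ofPred_exists, ofPred_and]
      refine MeasurableSet.iUnion fun n => (MeasurableSet.const _).inter
        (MeasurableSet.iUnion fun m => (MeasurableSet.const _).inter ?_)
      exact measurableSet_le ((hsec h.meas₂ m).sub (hsec h.meas₁ m)) (hsec (hdm n) m)
    · simp only [ofPred_forall]
      exact MeasurableSet.iInter fun m => measurableSet_le measurable_const (hI₁ m)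
    · simp only [ofPred_forall]
      exact MeasurableSet.iInter fun m => measurableSet_le measurable_const (hI₂ m)
  · rintro k l hkl ω ⟨hω, ⟨n, hn, m, hm, hnm⟩, h1, h2⟩
    have : (k:ℝ) ≤ l := by exact_mod_cast hkl
    exact ⟨hω, ⟨n, hn.trans hkl, m, hm.trans hkl, hnm⟩,
      fun m => (neg_le_neg this).trans (h1 m), fun m => (neg_le_neg this).trans (h2 m)⟩
  · filter_upwards [h.ae_mem, hcross, hN₁, hN₂] with ω hω ⟨n, m, hnm⟩ ⟨N₁, h1⟩ ⟨N₂, h2⟩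
    refine ⟨n + m + N₁ + N₂, hω, ⟨n, by omega, m, by omega, hnm⟩, fun j => ?_, fun j => ?_⟩
    · refine le_trans (neg_le_neg ?_) (h1 j)
      exact_mod_cast (by omega : N₁ ≤ n + m + N₁ + N₂)
    · refine le_trans (neg_le_neg ?_) (h2 j)
      exact_mod_cast (by omega : N₂ ≤ n + m + N₁ + N₂)
  · intro k
    refine ⟨k + (|p₁| + R₀ + (R₀ + |p₂|)) + (4 * R₀ + 1) * (k - -k), ?_⟩
    rintro ω ⟨hω, ⟨n, hn, m, hm, hnm⟩, h1, h2⟩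
    have hnk : (n:ℝ) ≤ k := by exact_mod_cast hn
    have hmk : (m:ℝ) ≤ k := by exact_mod_cast hm
    have hpc := hP ω hω
    have hR := h.pos
    have hdn := hd n ω hω
    refine ⟨fun x => f₁ x ω + d n x ω, hdn.contDiff_add hpc, hdn.supersolution hpc hδ.le hδ1,
      fun θ c hc₁ hc₂ x => ?_⟩
    have hg₂ : ∀ x, 0 ≤ x → p₂ * x - (k + (|p₁| + R₀ + (R₀ + |p₂|))) ≤ ∫ r in (0:ℝ)..x, f₂ r ω := by
      intro x hx
      have := integral_lower_bound_of_nat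
        (fun s t => hF.intervalIntegrable_orbit hm₂ (hb₂ ω hω) s t) (hb₂ ω hω) h2 hx
      simp_rw [← h.stat₂] at this
      rw [intervalIntegral.integral_sub (hpc.cont₂.intervalIntegrable _ _)
        intervalIntegrable_const, intervalIntegral.integral_const, smul_eq_mul] at this
      linarith [abs_nonneg p₁]
    have hg₁ : ∀ x, 0 ≤ x →
        ∫ r in (-x)..(0:ℝ), f₁ r ω ≤ p₁ * x + (k + (|p₁| + R₀ + (R₀ + |p₂|))) := by
      intro x hx
      have := integral_lower_bound_of_nat
        (fun s t => hF.reverse.intervalIntegrable_orbit hm₁ (hb₁ ω hω) s t) (hb₁ ω hω) h1 hx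
      simp_rw [← h.stat₁] at this
      have hcn : Continuous fun r => f₁ (-r) ω := hpc.cont₁.comp continuous_neg
      rw [intervalIntegral.integral_sub intervalIntegrable_const (hcn.intervalIntegrable _ _), intervalIntegral.integral_const,
        smul_eq_mul, intervalIntegral.integral_comp_neg (fun r => f₁ r ω), neg_zero] at this
      linarith [abs_nonneg p₂]
    have := hdn.integral_growth hpc hδ.le hδ1 (Nat.cast_nonneg m) (by simp) hnm hg₂ hg₁ hc₁ hc₂ x
    refine le_trans ?_ this
    gcongr

lemma ae_upper_bound_between (h : IsCorridor P τ a H lam f₁ f₂ G R₀) (hδ : 0 < δ) (hδ1 : δ ≤ 1)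
    (hgap : Ioo (∫ ω, f₁ 0 ω ∂P) (∫ ω, f₂ 0 ω ∂P) ∩ Eset P τ a H = ∅) {p₁ p₂ ρ : ℝ}
    (hp₁ : ∫ ω, f₁ 0 ω ∂P < p₁) (hp₂ : p₂ < ∫ ω, f₂ 0 ω ∂P) (hρ : 0 < ρ) (hρ1 : ρ ≤ 1) :
    ∀ᵐ ω ∂P, ∃ R₁ > 0, ∀ R ≥ R₁, ∀ y, |y| ≤ R → ∃ y', |y' - y| ≤ ρ * R ∧
      ∀ θ ∈ Ioo p₁ p₂, ∀ v, IsViscositySubsolution (fun x => a x ω) (fun p x => H p x ω) v →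
        UniformContinuousOn (fun q : ℝ × ℝ => v q.1 q.2) {q : ℝ × ℝ | 0 ≤ q.1} →
        (∀ x, v 0 x = θ * x) → ∀ t ≥ 0, v t y' ≤ θ * y' + ρ * R + (lam + δ) * t := by
  have hF := h.env.flow
  have := hF.prob
  obtain ⟨B, hBm, hBmono, hBae, hBC⟩ := h.exists_barrier_sets hδ hδ1 hgap hp₁ hp₂
  have hlim : Tendsto (fun k => P.real (B k)) atTop (nhds 1) := by
    have h1 := tendsto_measure_iUnion_atTop (μ := P) hBmono
    have h2 : P (⋃ k, B k) = 1 := by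
      rw [prob_compl_eq_zero_iff (MeasurableSet.iUnion hBm) |>.1]
      rw [← mem_ae_iff]
      filter_upwards [hBae] with ω hω
      exact mem_iUnion.2 hω
    rw [h2] at h1
    have h3 := (ENNReal.tendsto_toReal ENNReal.one_ne_top).comp h1
    rw [ENNReal.toReal_one] at h3
    exact h3
  obtain ⟨k, hk⟩ := (hlim.eventually (lt_mem_nhds (by linarith : 1 - ρ / 4 < 1))).exists
  obtain ⟨C, hC⟩ := hBC k
  filter_upwards [hF.ae_visits (hBm k) (by positivity) (by linarith) hk,
    hF.reverse.ae_visits (hBm k) (by positivity) (by linarith) hk] with ω ⟨N₁, h1⟩ ⟨N₂, h2⟩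
  refine ⟨(2 * |N₁| + 2 * |N₂| + |C| + 1) / ρ, by positivity, fun R hR y hy => ?_⟩
  rw [ge_iff_le, div_le_iff₀ hρ, mul_comm R] at hR
  have hN₁ := abs_nonneg N₁
  have hN₂ := abs_nonneg N₂
  have hC0 := abs_nonneg C
  have hR0 : 0 ≤ R := (abs_nonneg y).trans hy
  have hsmall : ρ * (ρ * R) ≤ ρ * R := mul_le_of_le_one_left (by positivity) hρ1
  have hvis : ∃ y', |y' - y| ≤ ρ * R ∧ τ y' ω ∈ B k := by
    rcases le_total 0 y with hy0 | hy0
    · rw [abs_of_nonneg hy0] at hy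
      by_contra! hno
      have := h1 y hy0 (ρ * R) (by positivity) fun r hr => hno r
        (abs_le.2 ⟨by linarith [hr.1], by linarith [hr.2]⟩)
      have h3 := mul_le_mul_of_nonneg_left hy hρ.le
      linarith [le_abs_self N₁]
    · rw [abs_of_nonpos hy0] at hy
      by_contra! hno
      have := h2 (-y) (by linarith) (ρ * R) (by positivity) fun r hr => hno (-r)
        (abs_le.2 ⟨by linarith [hr.2], by linarith [hr.1]⟩)
      have h3 := mul_le_mul_of_nonneg_left hy hρ.le
      linarith [le_abs_self N₂]
  obtain ⟨y', hy', hmem⟩ := hvis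
  refine ⟨y', hy', fun θ hθ v hv huc hinit t ht => ?_⟩
  have := (hC _ hmem).le (fun x => h.shift_eq h.env.a_stat x y' ω)
    (fun p x => h.shift_eq (f := fun x ω => H p x ω) (h.env.H_stat p) x y' ω) hθ hv huc hinit ht
  linarith [le_abs_self C]

end IsCorridor

section Setting

variable {Ω : Type} [MeasurableSpace Ω] {P : Measure Ω} {τ : ℝ → Ω → Ω}
  {a : ℝ → Ω → ℝ} {H : ℝ → ℝ → Ω → ℝ} {lam : ℝ} {f₁ f₂ : ℝ → Ω → ℝ}

lemma IsEnvironment.ae_upper_bound (hE : IsEnvironment P τ a H) (hf₁ : StatSol P τ a H lam f₁)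
    (hf₂ : StatSol P τ a H lam f₂) (hlt : (∫ ω, f₁ 0 ω ∂P) < ∫ ω, f₂ 0 ω ∂P)
    (hgap : Ioo (∫ ω, f₁ 0 ω ∂P) (∫ ω, f₂ 0 ω ∂P) ∩ Eset P τ a H = ∅) :
    ∀ᵐ ω ∂P, ∀ θ ∈ Ioo (∫ ω, f₁ 0 ω ∂P) (∫ ω, f₂ 0 ω ∂P), ∀ δ > 0, ∃ R₁ > 0, ∀ R ≥ R₁, ∀ y,
      |y| ≤ R → ∃ y', |y' - y| ≤ δ * R ∧
      ∀ v, IsViscositySubsolution (fun x => a x ω) (fun p x => H p x ω) v →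
        UniformContinuousOn (fun q : ℝ × ℝ => v q.1 q.2) {q : ℝ × ℝ | 0 ≤ q.1} →
        (∀ x, v 0 x = θ * x) → ∀ t ≥ 0, v t y' ≤ θ * y' + δ * R + (lam + δ) * t := by
  obtain ⟨G, R₀, h⟩ := hE.exists_isCorridor hf₁ hf₂ hlt
  have key : ∀ᵐ ω ∂P, ∀ (p₁ p₂ : ℚ) (n : ℕ), ∫ ω, f₁ 0 ω ∂P < p₁ → p₂ < ∫ ω, f₂ 0 ω ∂P →
      ∃ R₁ > 0, ∀ R ≥ R₁, ∀ y, |y| ≤ R → ∃ y', |y' - y| ≤ (1 / (n + 1 : ℝ)) * R ∧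
      ∀ θ ∈ Ioo (p₁:ℝ) p₂, ∀ v,
        IsViscositySubsolution (fun x => a x ω) (fun p x => H p x ω) v →
        UniformContinuousOn (fun q : ℝ × ℝ => v q.1 q.2) {q : ℝ × ℝ | 0 ≤ q.1} →
        (∀ x, v 0 x = θ * x) → ∀ t ≥ 0,
          v t y' ≤ θ * y' + (1 / (n + 1 : ℝ)) * R + (lam + 1 / (n + 1 : ℝ)) * t := by
    simp only [ae_all_iff]
    intro p₁ p₂ n hp₁ hp₂
    have h1 : (1:ℝ) / (n + 1) ≤ 1 := by
      rw [div_le_one (by positivity)]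
      linarith [Nat.cast_nonneg (α := ℝ) n]
    exact h.ae_upper_bound_between (by positivity) h1 hgap hp₁ hp₂ (by positivity) h1
  filter_upwards [key] with ω hω θ hθ δ hδ
  obtain ⟨p₁, hp₁, hp₁'⟩ := exists_rat_btwn hθ.1
  obtain ⟨p₂, hp₂, hp₂'⟩ := exists_rat_btwn hθ.2
  obtain ⟨n, hn⟩ := exists_nat_one_div_lt hδ
  obtain ⟨R₁, hR₁, hR⟩ := hω p₁ p₂ n hp₁ hp₂'
  refine ⟨R₁, hR₁, fun R hRR y hy => ?_⟩
  obtain ⟨y', hy', hv⟩ := hR R hRR y hy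
  have hR0 : 0 ≤ R := (abs_nonneg y).trans hy
  refine ⟨y', hy'.trans (by gcongr), fun v h1 h2 h3 t ht => ?_⟩
  refine (hv θ ⟨hp₁', hp₂⟩ v h1 h2 h3 t ht).trans ?_
  gcongr

lemma IsViscositySupersolution.neg {alpha : ℝ → ℝ} {h v : ℝ → ℝ → ℝ}
    (hv : IsViscositySupersolution alpha h v) :
    IsViscositySubsolution alpha (fun p x => -h (-p) x) fun t x => -v t x := by
  intro t₀ x₀ ht₀ φ hφ hmax
  have hmin : IsLocalMin (fun q : ℝ × ℝ => v q.1 q.2 - -φ q) (t₀, x₀) := by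
    have := hmax.neg
    simpa [sub_eq_add_neg, add_comm] using this
  have := hv t₀ x₀ ht₀ (fun q => -φ q) hφ.neg hmin
  simp only [deriv.fun_neg] at this
  have h2 : deriv (fun x => -deriv (fun x => φ (t₀, x)) x) x₀ =
      -deriv (deriv fun x => φ (t₀, x)) x₀ := deriv.fun_neg
  rw [show (deriv fun x => -φ (t₀, x)) = fun x => -deriv (fun x => φ (t₀, x)) x from
    funext fun x => deriv.fun_neg, h2] at this
  linarith

lemma IsEnvironment.ae_lower_bound (hE : IsEnvironment P τ a H) (hf₁ : StatSol P τ a H lam f₁)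
    (hf₂ : StatSol P τ a H lam f₂) (hlt : (∫ ω, f₁ 0 ω ∂P) < ∫ ω, f₂ 0 ω ∂P)
    (hgap : Ioo (∫ ω, f₁ 0 ω ∂P) (∫ ω, f₂ 0 ω ∂P) ∩ Eset P τ a H = ∅) :
    ∀ᵐ ω ∂P, ∀ θ ∈ Ioo (∫ ω, f₁ 0 ω ∂P) (∫ ω, f₂ 0 ω ∂P), ∀ δ > 0, ∃ R₁ > 0, ∀ R ≥ R₁, ∀ y,
      |y| ≤ R → ∃ y', |y' - y| ≤ δ * R ∧
      ∀ v, IsViscositySupersolution (fun x => a x ω) (fun p x => H p x ω) v →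
        UniformContinuousOn (fun q : ℝ × ℝ => v q.1 q.2) {q : ℝ × ℝ | 0 ≤ q.1} →
        (∀ x, v 0 x = θ * x) → ∀ t ≥ 0, θ * y' - δ * R + (lam - δ) * t ≤ v t y' := by
  have hgap' : Ioo (∫ ω, -f₂ 0 ω ∂P) (∫ ω, -f₁ 0 ω ∂P) ∩
      Eset P τ a (fun p x ω => -H (-p) x ω) = ∅ := by
    rw [integral_neg, integral_neg, eq_empty_iff_forall_notMem]
    rintro θ ⟨hθ, hθE⟩
    have : -θ ∈ Ioo (∫ ω, f₁ 0 ω ∂P) (∫ ω, f₂ 0 ω ∂P) ∩ Eset P τ a H :=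
      ⟨⟨by linarith [hθ.2], by linarith [hθ.1]⟩, Eset_reflect hθE⟩
    rw [hgap] at this
    exact this
  filter_upwards [hE.reflect.ae_upper_bound hf₂.reflect hf₁.reflect
    (by simpa [integral_neg] using hlt) hgap'] with ω hω θ hθ δ hδ
  obtain ⟨R₁, hR₁, hR⟩ := hω (-θ) (by
    rw [integral_neg, integral_neg]
    exact ⟨by linarith [hθ.2], by linarith [hθ.1]⟩) δ hδ
  refine ⟨R₁, hR₁, fun R hRR y hy => ?_⟩
  obtain ⟨y', hy', hv⟩ := hR R hRR y hy
  refine ⟨y', hy', fun v h1 h2 h3 t ht => ?_⟩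
  have := hv (fun t x => -v t x) h1.neg
    (uniformContinuous_neg.comp_uniformContinuousOn h2) (fun x => by rw [h3, neg_mul]) t ht
  linarith

end Setting

/-- Nearby coarse bounds transfer to a uniform bound after rescaling. -/
lemma rescaled_upper_bound {v : ℝ → ℝ → ℝ} {θ lam L δ R₁ T M : ℝ} (hL : 0 < L)
    (hδ : 0 < δ)
    (hv : ∀ t ≥ 0, ∀ x y, |v t x - v t y| ≤ 1 + L * |x - y|)
    (hb : ∀ R ≥ R₁, ∀ y, |y| ≤ R → ∃ y', |y' - y| ≤ δ * R ∧
      ∀ t ≥ 0, v t y' ≤ θ * y' + δ * R + (lam + δ) * t)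
    {ε : ℝ} (hε : 0 < ε) (hεR : ε * R₁ ≤ M) {t x : ℝ} (ht : t ∈ Icc 0 T) (hx : x ∈ Icc (-M) M) :
    ε * v (t / ε) (x / ε) - (t * lam + θ * x) ≤ ((|θ| + 1 + L) * M + T) * δ + ε := by
  have ht0 : 0 ≤ t / ε := div_nonneg ht.1 hε.le
  have hR : M / ε ≥ R₁ := by
    rw [ge_iff_le, le_div_iff₀ hε]; linarith
  obtain ⟨y', hy', hle⟩ := hb (M / ε) hR (x / ε) (by
    rw [abs_div, abs_of_pos hε]
    gcongr
    exact abs_le.2 hx)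
  have h1 := hle _ ht0
  have h2 := (abs_le.1 (hv _ ht0 (x / ε) y')).2
  rw [abs_sub_comm] at h2
  have h3 : θ * (y' - x / ε) ≤ |θ| * (δ * (M / ε)) :=
    (le_abs_self _).trans (by rw [abs_mul]; gcongr)
  have h4 := mul_le_mul_of_nonneg_left hy' hL.le
  have h5 : v (t / ε) (x / ε) ≤
      θ * (x / ε) + (|θ| + 1 + L) * (δ * (M / ε)) + (lam + δ) * (t / ε) + 1 := by linarith
  have h6 := mul_le_mul_of_nonneg_left h5 hε.le
  have h7 : ε * (θ * (x / ε) + (|θ| + 1 + L) * (δ * (M / ε)) + (lam + δ) * (t / ε) + 1) =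
      θ * x + (|θ| + 1 + L) * M * δ + (lam + δ) * t + ε := by
    field_simp
  have h8 := mul_le_mul_of_nonneg_left ht.2 hδ.le
  linarith

lemma IsEnvironment.ae_uniform_convergence {Ω : Type} [MeasurableSpace Ω] {P : Measure Ω}
    {τ : ℝ → Ω → Ω} {a : ℝ → Ω → ℝ} {H : ℝ → ℝ → Ω → ℝ} {lam : ℝ} {f₁ f₂ : ℝ → Ω → ℝ}
    (hE : IsEnvironment P τ a H) (hf₁ : StatSol P τ a H lam f₁) (hf₂ : StatSol P τ a H lam f₂)
    (hlt : ∫ ω, f₁ 0 ω ∂P < ∫ ω, f₂ 0 ω ∂P)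
    (hgap : Ioo (∫ ω, f₁ 0 ω ∂P) (∫ ω, f₂ 0 ω ∂P) ∩ Eset P τ a H = ∅) :
    ∀ᵐ ω ∂P, ∀ θ ∈ Ioo (∫ ω, f₁ 0 ω ∂P) (∫ ω, f₂ 0 ω ∂P), ∀ v,
      IsViscositySolution (fun x => a x ω) (fun p x => H p x ω) v →
      UniformContinuousOn (fun q : ℝ × ℝ => v q.1 q.2) {q : ℝ × ℝ | 0 ≤ q.1} →
      (∀ x, v 0 x = θ * x) → ∀ T > (0:ℝ), ∀ M > (0:ℝ), ∀ η > (0:ℝ), ∃ ε₀ > (0:ℝ),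
        ∀ ε : ℝ, 0 < ε → ε < ε₀ → ∀ t ∈ Icc (0:ℝ) T, ∀ x ∈ Icc (-M) M,
          |ε * v (t / ε) (x / ε) - (t * lam + θ * x)| ≤ η := by
  filter_upwards [hE.ae_upper_bound hf₁ hf₂ hlt hgap, hE.ae_lower_bound hf₁ hf₂ hlt hgap]
    with ω hup hlow θ hθ v hsol huc hinit T hT M hM η hη
  obtain ⟨L, hL, hLx, -⟩ := exists_coarse_lipschitz huc
  have hK : 0 < (|θ| + 1 + L) * M + T := by positivity
  set δ := η / (2 * ((|θ| + 1 + L) * M + T)) with hδ_def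
  have hδ : 0 < δ := by positivity
  have hKδ : ((|θ| + 1 + L) * M + T) * δ = η / 2 := by
    rw [hδ_def]; field_simp
  obtain ⟨R₁, hR₁, h1⟩ := hup θ hθ δ hδ
  obtain ⟨R₂, hR₂, h2⟩ := hlow θ hθ δ hδ
  refine ⟨min (η / 2) (M / (R₁ + R₂)), by positivity, fun ε hε hlt t ht x hx => ?_⟩
  obtain ⟨hεη, hεR⟩ := lt_min_iff.1 hlt
  rw [lt_div_iff₀ (by positivity)] at hεR
  have hε₁ := mul_pos hε hR₁
  have hε₂ := mul_pos hε hR₂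
  have hU := rescaled_upper_bound hL hδ hLx (θ := θ) (lam := lam) (fun R hR y hy => by
    obtain ⟨y', hy', hle⟩ := h1 R hR y hy
    exact ⟨y', hy', hle v hsol.1 huc hinit⟩) hε (by linarith) ht hx
  have hD := rescaled_upper_bound (v := fun t x => -v t x) hL hδ (fun s hs x y => by
      rw [neg_sub_neg, abs_sub_comm]; exact hLx s hs x y)
    (θ := -θ) (lam := -lam) (fun R hR y hy => by
    obtain ⟨y', hy', hle⟩ := h2 R hR y hy
    exact ⟨y', hy', fun s hs => by linarith [hle v hsol.2 huc hinit s hs]⟩)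
    hε (by linarith) ht hx
  rw [abs_neg] at hD
  exact abs_le.2 ⟨by linarith, by linarith⟩

theorem loc_uniform_convergence_on_gap
    {Ω : Type} [MeasurableSpace Ω] (P : Measure Ω) (τ : ℝ → Ω → Ω)
    (a : ℝ → Ω → ℝ) (H : ℝ → ℝ → Ω → ℝ) (G_L G_U : ℝ → ℝ)
    (hset : HJSetting P τ a H G_L G_U)
    (u : ℝ → Ω → ℝ → ℝ → ℝ)
    (hu_sol : ∀ θ ω, IsViscositySolution (fun x => a x ω) (fun p x => H p x ω) (u θ ω))
    (hu_uc : ∀ θ ω, UniformContinuousOn (fun q : ℝ × ℝ => u θ ω q.1 q.2) {q : ℝ × ℝ | 0 ≤ q.1})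
    (hu_init : ∀ θ ω x, u θ ω 0 x = θ * x)
    (hu_unique : ∀ θ ω (v : ℝ → ℝ → ℝ),
      IsViscositySolution (fun x => a x ω) (fun p x => H p x ω) v →
      UniformContinuousOn (fun q : ℝ × ℝ => v q.1 q.2) {q : ℝ × ℝ | 0 ≤ q.1} →
      (∀ x, v 0 x = θ * x) → ∀ t x, 0 ≤ t → v t x = u θ ω t x)
    (θ₁ θ₂ : ℝ) (hθ : θ₁ < θ₂) (hgap : Ioo θ₁ θ₂ ∩ Eset P τ a H = ∅)
    (lambar : ℝ) (f₁ f₂ : ℝ → Ω → ℝ)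
    (hf₁ : StatSol P τ a H lambar f₁) (hf₂ : StatSol P τ a H lambar f₂)
    (hmean₁ : (∫ ω, f₁ 0 ω ∂P) = θ₁) (hmean₂ : (∫ ω, f₂ 0 ω ∂P) = θ₂) :
    (∃ Ωbar : Set Ω, MeasurableSet Ωbar ∧ P Ωbar = 1 ∧
      ∀ θ ∈ Ioo θ₁ θ₂, ∀ ω ∈ Ωbar,
        Tendsto (fun ε : ℝ => ε * u θ ω (1 / ε) 0) (nhdsWithin 0 (Ioi 0)) (nhds lambar)) ∧
    ∀ θ ∈ Ioo θ₁ θ₂, ∃ Ω₀ : Set Ω, MeasurableSet Ω₀ ∧ P Ω₀ = 1 ∧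
      ∀ ω ∈ Ω₀, ∀ T > (0:ℝ), ∀ M > (0:ℝ), ∀ η > (0:ℝ), ∃ ε₀ > (0:ℝ),
        ∀ ε : ℝ, 0 < ε → ε < ε₀ → ∀ t ∈ Icc (0:ℝ) T, ∀ x ∈ Icc (-M) M,
          |ε * u θ ω (t / ε) (x / ε) - (t * lambar + θ * x)| ≤ η := by
  subst hmean₁ hmean₂
  have hE := hset.isEnvironment
  have := hE.flow.prob
  obtain ⟨N, hN, hNm, hN0⟩ := exists_measurable_superset_of_null
    (ae_iff.1 (hE.ae_uniform_convergence hf₁ hf₂ hθ hgap))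
  have hprob : P Nᶜ = 1 := (prob_compl_eq_one_iff hNm).2 hN0
  have key : ∀ θ ∈ Ioo (∫ ω, f₁ 0 ω ∂P) (∫ ω, f₂ 0 ω ∂P), ∀ ω ∈ Nᶜ, ∀ T > (0:ℝ), ∀ M > (0:ℝ),
      ∀ η > (0:ℝ), ∃ ε₀ > (0:ℝ), ∀ ε : ℝ, 0 < ε → ε < ε₀ → ∀ t ∈ Icc (0:ℝ) T,
        ∀ x ∈ Icc (-M) M, |ε * u θ ω (t / ε) (x / ε) - (t * lambar + θ * x)| ≤ η := by
    intro θ hθ ω hω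
    exact not_not.1 (fun h => hω (hN h)) θ hθ _ (hu_sol θ ω) (hu_uc θ ω) (hu_init θ ω)
  refine ⟨⟨Nᶜ, hNm.compl, hprob, fun θ hθ ω hω => ?_⟩,
    fun θ hθ => ⟨Nᶜ, hNm.compl, hprob, key θ hθ⟩⟩
  rw [Metric.tendsto_nhdsWithin_nhds]
  intro η hη
  obtain ⟨ε₀, hε₀, h⟩ := key θ hθ ω hω 1 one_pos 1 one_pos (η / 2) (half_pos hη)
  refine ⟨ε₀, hε₀, fun {ε} hε hdist => ?_⟩
  rw [Real.dist_0_eq_abs, abs_of_pos hε] at hdist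
  have := h ε hε hdist 1 (by simp) 0 (by simp)
  rw [zero_div, one_mul, mul_zero, add_zero] at this
  rw [Real.dist_eq]
  linarith
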